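/- The operators b̄_ij (0 ≤ i,j ≤ N) pairwise commute, and there is an algebra isomorphism from the unital C-subalgebra of End_C(V_1) generated by the operators b̄_ij onto the center of H which sends b̄_ij to c_ij for all 0 ≤ i,j ≤ N. -/

import Mathlib

open MvPolynomial

noncomputable section

abbrev Rzl (N : ℕ) := MvPolynomial (Fin N ⊕ Fin N) ℂ

def permHat (N : ℕ) (σ : Equiv.Perm (Fin N)) : Rzl N ≃ₐ[ℂ] Rzl N :=
  renameEquiv ℂ (Equiv.sumCongr σ σ)

/-- The automorphism `σ̂` as an endomorphism of `ℂ[z,λ]`. -/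
def permOp (N : ℕ) (σ : Equiv.Perm (Fin N)) : Module.End ℂ (Rzl N) :=
  (permHat N σ).toLinearMap

/-- The automorphism `s_ij^z` exchanging `z_i ↔ z_j` only. -/
def sZ (N : ℕ) (i j : Fin N) : Rzl N ≃ₐ[ℂ] Rzl N :=
  renameEquiv ℂ (Equiv.sumCongr (Equiv.swap i j) (Equiv.refl (Fin N)))

/-- The automorphism `s_ij^λ` exchanging `λ_i ↔ λ_j` only. -/
def sL (N : ℕ) (i j : Fin N) : Rzl N ≃ₐ[ℂ] Rzl N :=
  renameEquiv ℂ (Equiv.sumCongr (Equiv.refl (Fin N)) (Equiv.swap i j))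

/-- Multiplication by a polynomial, as an endomorphism of `ℂ[z,λ]`. -/
def mulP (N : ℕ) (p : Rzl N) : Module.End ℂ (Rzl N) := LinearMap.mulLeft ℂ p

/-- Product of the endomorphisms `f i`, `i ∈ T`, taken in increasing order of `i`
(the order is irrelevant when the factors pairwise commute). -/
def ordProd {N : ℕ} (T : Finset (Fin N)) (f : Fin N → Module.End ℂ (Rzl N)) :
    Module.End ℂ (Rzl N) :=
  ((T.sort (· ≤ ·)).map f).prod

/-- The universal central polynomial evaluated at `(u,v)`:
`P(u,v) = (−1)^N Σ_σ sgn(σ) (Σ_{T ⊆ Fix σ} (−1)^{|T|} (Π_{i∈T}(v−λ_i))·(Π_{i∈T}(u−K_i))) ∘ σ̂`. -/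
def Puv {N : ℕ} (K : Fin N → Module.End ℂ (Rzl N)) (u v : ℂ) : Module.End ℂ (Rzl N) :=
  ((-1 : ℤ) ^ N) • ∑ σ : Equiv.Perm (Fin N), (Equiv.Perm.sign σ : ℤ) •
    ((∑ T ∈ (Finset.univ.filter fun i => σ i = i).powerset,
        ((-1 : ℤ) ^ T.card) •
          (mulP N (∏ i ∈ T, ((C v : Rzl N) - X (Sum.inr i))) *
            ordProd T (fun i => u • (1 : Module.End ℂ (Rzl N)) - K i))) * permOp N σ)

set_option synthInstance.maxHeartbeats 1000000 in

/-- The free `ℂ[z,λ]`-module `V_1` with basis `{ε_τ : τ ∈ S_N}`, realized as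
functions `S_N → ℂ[z,λ]` (the value at `τ` is the coefficient of `ε_τ`). -/
abbrev V1 (N : ℕ) := Equiv.Perm (Fin N) → Rzl N

/-- Componentwise multiplication operator on `V_1`. -/
def mulDiag {N : ℕ} (g : Equiv.Perm (Fin N) → Rzl N) : Module.End ℂ (V1 N) where
  toFun F := fun τ => g τ * F τ
  map_add' F G := by funext τ; simp [mul_add]
  map_smul' c F := by funext τ; simp [Pi.smul_apply, mul_smul_comm]

/-- The shift `ε_τ ↦ ε_{στ}` on `V_1`. -/
def shiftOp {N : ℕ} (σ : Equiv.Perm (Fin N)) : Module.End ℂ (V1 N) :=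
  LinearMap.funLeft ℂ (Rzl N) (fun ρ => σ⁻¹ * ρ)

/-- The action `P^B(u,v)` on `V_1` of the universal Bethe polynomial of the
`gl_N` Gaudin model:
`P^B(u,v)(r ε_τ) = (−1)^N Σ_σ sgn σ (Π_{i,σ(i)=i}(1−(u−z_{τ⁻¹(i)})(v−λ_i))) r ε_{στ}`. -/
def PB (N : ℕ) (u v : ℂ) : Module.End ℂ (V1 N) :=
  ((-1 : ℤ) ^ N) • ∑ σ : Equiv.Perm (Fin N), (Equiv.Perm.sign σ : ℤ) •
    (shiftOp σ * mulDiag (fun τ => ∏ i ∈ Finset.univ.filter (fun i => σ i = i),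
        (1 - ((C u : Rzl N) - X (Sum.inl (τ⁻¹ i))) * ((C v : Rzl N) - X (Sum.inr i)))))


/-- The realization `H` of the rational Cherednik algebra: the unital subalgebra of
`End_ℂ(ℂ[z,λ])` generated by the multiplications by `λ_1,…,λ_N`, the operators
`K_1,…,K_N` and the automorphisms `σ̂`. -/
def cherednik (N : ℕ) (K : Fin N → Module.End ℂ (Rzl N)) :
    Subalgebra ℂ (Module.End ℂ (Rzl N)) :=
  Algebra.adjoin ℂ
    ((Set.range fun i => mulP N (X (Sum.inr i))) ∪ Set.range K ∪ Set.range (permOp N))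

/-- The center of `H`, as a subalgebra of `End_ℂ(ℂ[z,λ])`. -/
def cherednikCenter (N : ℕ) (K : Fin N → Module.End ℂ (Rzl N)) :
    Subalgebra ℂ (Module.End ℂ (Rzl N)) :=
  cherednik N K ⊓ Subalgebra.centralizer ℂ (cherednik N K : Set (Module.End ℂ (Rzl N)))

section NormalOrdered

variable {A : Type*} [Ring A] {N : ℕ}

/-- The relations of the rational Cherednik algebra at `t = 0` between the elements
`a i`, `κ i` and the group elements `W σ`. -/
structure CherednikRelations (a κ : Fin N → A) (W : Equiv.Perm (Fin N) →* A) : Prop where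
  commute_left : ∀ i j, a i * a j = a j * a i
  perm_left : ∀ σ i, W σ * a i = a (σ i) * W σ
  perm_right : ∀ σ i, W σ * κ i = κ (σ i) * W σ
  cross : ∀ i j, i ≠ j → κ i * a j = a j * κ i - W (Equiv.swap i j)
  cross_self : ∀ i, κ i * a i = a i * κ i + ∑ j ∈ Finset.univ.erase i, W (Equiv.swap i j)

lemma CherednikRelations.bracket_commute_aux {a κ : Fin N → A} {W : Equiv.Perm (Fin N) →* A}
    (h : CherednikRelations a κ W) {i j : Fin N} (hij : i ≠ j) :
    (κ i * κ j - κ j * κ i) * a j = a j * (κ i * κ j - κ j * κ i) := by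
  have h1 : (∑ l ∈ Finset.univ.erase j, W (Equiv.swap j l)) * κ i =
      κ i * (∑ l ∈ Finset.univ.erase j, W (Equiv.swap j l)) - κ i * W (Equiv.swap i j)
        + κ j * W (Equiv.swap i j) := by
    have hi : i ∈ Finset.univ.erase j := by simp [hij]
    rw [← Finset.add_sum_erase _ _ hi, add_mul, mul_add, h.perm_right, Equiv.swap_apply_right,
      Equiv.swap_comm j i, Finset.sum_mul, Finset.mul_sum]
    rw [Finset.sum_congr rfl (g := fun l => κ i * W (Equiv.swap j l))]
    · noncomm_ring
    · intro l hl
      simp only [Finset.mem_erase, Finset.mem_univ, and_true] at hl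
      rw [h.perm_right, Equiv.swap_apply_of_ne_of_ne hij (Ne.symm hl.1)]
  have h2 := h.perm_right (Equiv.swap i j) j
  rw [Equiv.swap_apply_right] at h2
  have h3 := h.cross i j hij
  have h4 := h.cross_self j
  set Y := ∑ l ∈ Finset.univ.erase j, W (Equiv.swap j l)
  calc _ = κ i * (κ j * a j) - κ j * (κ i * a j) := by noncomm_ring
    _ = (κ i * a j) * κ j + κ i * Y - (κ j * a j) * κ i + κ j * W (Equiv.swap i j) := by
      conv_lhs => rw [h4, h3]
      noncomm_ring
    _ = a j * (κ i * κ j - κ j * κ i) - W (Equiv.swap i j) * κ j + κ i * Y - Y * κ i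
        + κ j * W (Equiv.swap i j) := by rw [h4, h3]; noncomm_ring
    _ = _ := by rw [h1, h2]; noncomm_ring

lemma CherednikRelations.bracket_commute {a κ : Fin N → A} {W : Equiv.Perm (Fin N) →* A}
    (h : CherednikRelations a κ W) (i j k : Fin N) :
    (κ i * κ j - κ j * κ i) * a k = a k * (κ i * κ j - κ j * κ i) := by
  by_cases hij : i = j
  · simp [hij]
  by_cases hjk : j = k
  · exact hjk ▸ h.bracket_commute_aux hij
  by_cases hik : i = k
  · have := h.bracket_commute_aux (Ne.symm hij)
    rw [← hik, ← neg_sub, neg_mul, mul_neg, this]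
  have h2 := h.perm_right (Equiv.swap i k) j
  rw [Equiv.swap_apply_of_ne_of_ne (Ne.symm hij) hjk] at h2
  have h3 := h.perm_right (Equiv.swap j k) i
  rw [Equiv.swap_apply_of_ne_of_ne hij hik] at h3
  have h4 := h.cross i k hik
  have h5 := h.cross j k hjk
  calc _ = κ i * (κ j * a k) - κ j * (κ i * a k) := by noncomm_ring
    _ = (κ i * a k) * κ j - κ i * W (Equiv.swap j k) - (κ j * a k) * κ i
        + κ j * W (Equiv.swap i k) := by
      conv_lhs => rw [h4, h5]
      noncomm_ring
    _ = a k * (κ i * κ j - κ j * κ i) - W (Equiv.swap i k) * κ j + W (Equiv.swap j k) * κ i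
        - κ i * W (Equiv.swap j k) + κ j * W (Equiv.swap i k) := by rw [h4, h5]; noncomm_ring
    _ = _ := by rw [h2, h3]; noncomm_ring

/-- `F S` is the normally ordered product of the factors `1 - a i * κ i`, `i ∈ S`. -/
structure IsNormalOrdered (a κ : Fin N → A) (F : Finset (Fin N) → A) : Prop where
  empty_eq : F ∅ = 1
  insert_eq : ∀ S k, k ∉ S → F (insert k S) = F S - a k * F S * κ k

variable {a κ : Fin N → A} {W : Equiv.Perm (Fin N) →* A} {F : Finset (Fin N) → A}


lemma IsNormalOrdered.bracket_of_notMem (hF : IsNormalOrdered a κ F)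
    (h : CherednikRelations a κ W) {k : Fin N} (S : Finset (Fin N)) (hk : k ∉ S) :
    F S * a k = a k * F S + ∑ i ∈ S, a i * F (S.erase i) * W (Equiv.swap i k) := by
  induction S using Finset.induction_on with
  | empty => simp [hF.empty_eq]
  | insert m S hm ih =>
    simp only [Finset.mem_insert, not_or] at hk
    have ih := ih hk.2
    have hsum : ∑ i ∈ S, a i * F ((insert m S).erase i) * W (Equiv.swap i k) =
        ∑ i ∈ S, a i * F (S.erase i) * W (Equiv.swap i k) -
          a m * (∑ i ∈ S, a i * F (S.erase i) * W (Equiv.swap i k)) * κ m := by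
      rw [Finset.mul_sum, Finset.sum_mul, ← Finset.sum_sub_distrib]
      refine Finset.sum_congr rfl fun i hi => ?_
      have him : i ≠ m := fun e => hm (e ▸ hi)
      have h2 := h.perm_right (Equiv.swap i k) m
      rw [Equiv.swap_apply_of_ne_of_ne him.symm (Ne.symm hk.1)] at h2
      rw [Finset.erase_insert_of_ne (Ne.symm him), hF.insert_eq _ _ (by simp [hm])]
      calc _ = a i * F (S.erase i) * W (Equiv.swap i k)
            - (a i * a m) * F (S.erase i) * (κ m * W (Equiv.swap i k)) := by noncomm_ring
        _ = _ := by rw [h.commute_left i m, ← h2]; noncomm_ring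
    rw [Finset.sum_insert hm, Finset.erase_insert hm, hsum, hF.insert_eq S m hm]
    have hx := h.cross m k (Ne.symm hk.1)
    have hc := h.commute_left m k
    set B := ∑ i ∈ S, a i * F (S.erase i) * W (Equiv.swap i k)
    calc (F S - a m * F S * κ m) * a k = F S * a k - a m * F S * (κ m * a k) := by noncomm_ring
      _ = F S * a k - a m * (F S * a k) * κ m + a m * F S * W (Equiv.swap m k) := by
        rw [hx]; noncomm_ring
      _ = (a k * F S + B) - (a m * a k) * F S * κ m - a m * B * κ m
            + a m * F S * W (Equiv.swap m k) := by rw [ih]; noncomm_ring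
      _ = _ := by rw [hc]; noncomm_ring

lemma IsNormalOrdered.bracket_of_mem (hF : IsNormalOrdered a κ F)
    (h : CherednikRelations a κ W) {k : Fin N} (S : Finset (Fin N)) (hk : k ∈ S) :
    F S * a k = a k * F S
      - ∑ i ∈ S.erase k, (a k - a i) * F ((S.erase k).erase i) * W (Equiv.swap i k)
      - a k * ∑ j ∈ Sᶜ, F (S.erase k) * W (Equiv.swap j k) := by
  obtain ⟨S, hkS, rfl⟩ : ∃ S', k ∉ S' ∧ S = insert k S' :=
    ⟨S.erase k, by simp, (Finset.insert_erase hk).symm⟩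
  clear hk
  rename' hkS => hk
  rw [Finset.erase_insert hk]
  have h1 := hF.bracket_of_notMem h S hk
  have h2 : (∑ i ∈ S, a i * F (S.erase i) * W (Equiv.swap i k)) * κ k =
      ∑ i ∈ S, F (S.erase i) * W (Equiv.swap i k) - ∑ i ∈ S, F S * W (Equiv.swap i k) := by
    rw [Finset.sum_mul, ← Finset.sum_sub_distrib]
    refine Finset.sum_congr rfl fun i hi => ?_
    have h3 := h.perm_right (Equiv.swap i k) k
    rw [Equiv.swap_apply_right] at h3
    have h4 := hF.insert_eq (S.erase i) i (by simp)
    rw [Finset.insert_erase hi] at h4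
    rw [h4, mul_assoc, h3]
    noncomm_ring
  have h5 : ∑ j ∈ Finset.univ.erase k, W (Equiv.swap k j) =
      ∑ i ∈ S, W (Equiv.swap i k) + ∑ j ∈ (insert k S)ᶜ, W (Equiv.swap j k) := by
    rw [← Finset.sum_union]
    · refine Finset.sum_congr ?_ fun j _ => by rw [Equiv.swap_comm]
      ext j
      by_cases hj : j = k
      · simp [hj, hk]
      · by_cases j ∈ S <;> simp_all
    · rw [Finset.disjoint_left]
      intro j hj; simp [hj]
  have hx := h.cross_self k
  rw [h5] at hx
  rw [hF.insert_eq S k hk]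
  have h6 : ∑ i ∈ S, (a k - a i) * F (S.erase i) * W (Equiv.swap i k) =
      a k * ∑ i ∈ S, F (S.erase i) * W (Equiv.swap i k)
        - ∑ i ∈ S, a i * F (S.erase i) * W (Equiv.swap i k) := by
    rw [Finset.mul_sum, ← Finset.sum_sub_distrib]
    exact Finset.sum_congr rfl fun i _ => by noncomm_ring
  rw [h6]
  simp only [← Finset.mul_sum] at h2 ⊢
  set B := ∑ i ∈ S, a i * F (S.erase i) * W (Equiv.swap i k)
  set E := ∑ i ∈ S, F (S.erase i) * W (Equiv.swap i k)
  set X := ∑ i ∈ S, W (Equiv.swap i k)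
  set Y := ∑ j ∈ (insert k S)ᶜ, W (Equiv.swap j k)
  calc (F S - a k * F S * κ k) * a k = F S * a k - a k * F S * (κ k * a k) := by noncomm_ring
    _ = F S * a k - a k * (F S * a k) * κ k - a k * F S * X - a k * F S * Y := by
      rw [hx]; noncomm_ring
    _ = (a k * F S + B) - a k * a k * F S * κ k - a k * (B * κ k)
        - a k * F S * X - a k * F S * Y := by rw [h1]; noncomm_ring
    _ = _ := by rw [h2]; noncomm_ring

/-- The alternating sum of the normally ordered products commutes with the `a k`. -/
lemma IsNormalOrdered.sum_commute (hF : IsNormalOrdered a κ F)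
    (h : CherednikRelations a κ W) (k : Fin N) :
    (∑ σ : Equiv.Perm (Fin N), (Equiv.Perm.sign σ : ℤ) •
      (F (Finset.univ.filter fun i => σ i = i) * W σ)) * a k =
    a k * ∑ σ : Equiv.Perm (Fin N), (Equiv.Perm.sign σ : ℤ) •
      (F (Finset.univ.filter fun i => σ i = i) * W σ) := by
  set G : Equiv.Perm (Fin N) → A := fun σ => (Equiv.Perm.sign σ : ℤ) •
      (F (Finset.univ.filter fun i => σ i = i) * W σ) with hG
  let c : Equiv.Perm (Fin N) → Fin N → A := fun σ j =>
    if j = σ k then 0 else if σ k = k then (if σ j = j then a k - a j else a k)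
      else (if σ j = j then - a j else 0)
  have key : ∀ σ, G σ * a k - a k * G σ = (a (σ k) - a k) * G σ +
      ∑ j, c σ j * G (Equiv.swap j (σ k) * σ) := by
    intro σ
    have hGa : G σ * a k - a k * G σ = (Equiv.Perm.sign σ : ℤ) •
        ((F (Finset.univ.filter fun i => σ i = i) * a (σ k)
          - a k * F (Finset.univ.filter fun i => σ i = i)) * W σ) := by
      simp only [hG]
      rw [smul_mul_assoc, mul_smul_comm, ← smul_sub, mul_assoc, h.perm_left, sub_mul]
      simp only [mul_assoc]
    set S : Finset (Fin N) := Finset.univ.filter fun i => σ i = i with hS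
    have hGs : ∀ j, j ≠ σ k → G (Equiv.swap j (σ k) * σ) = -((Equiv.Perm.sign σ : ℤ) •
        (F (Finset.univ.filter fun i => Equiv.swap j (σ k) (σ i) = i)
          * W (Equiv.swap j (σ k)) * W σ)) := by
      intro j hj
      simp only [hG, Equiv.Perm.sign_swap hj, mul_assoc,
        Equiv.Perm.coe_mul, Function.comp_apply, map_mul]
      simp
      rfl
    have hGσ : G σ = (Equiv.Perm.sign σ : ℤ) • (F S * W σ) := rfl
    rw [hGa, hGσ]
    by_cases hk : σ k = k
    · have hkS : k ∈ S := by simp [hS, hk]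
      rw [hk] at hGs ⊢
      rw [hF.bracket_of_mem h S hkS, sub_self, zero_mul, zero_add]
      have h1 : ∑ i ∈ S.erase k, (a k - a i) * F ((S.erase k).erase i) * W (Equiv.swap i k) =
          ∑ i, if i ∈ S.erase k then
            (a k - a i) * F ((S.erase k).erase i) * W (Equiv.swap i k) else 0 := by
        rw [Finset.sum_ite_mem, Finset.univ_inter]
      have h2 : ∑ j ∈ Sᶜ, F (S.erase k) * W (Equiv.swap j k) =
          ∑ j, if j ∈ Sᶜ then F (S.erase k) * W (Equiv.swap j k) else 0 := by
        rw [Finset.sum_ite_mem, Finset.univ_inter]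
      have h3 : ∀ p q r : A, p - q - r - p = -(q + r) := fun p q r => by abel
      rw [h1, h2, h3, Finset.mul_sum, ← Finset.sum_add_distrib,
        neg_mul, smul_neg, Finset.sum_mul, Finset.smul_sum, ← Finset.sum_neg_distrib]
      refine Finset.sum_congr rfl fun j _ => ?_
      by_cases hjk : j = k
      · simp [c, hjk, hk, hkS]
      have hfix : (Finset.univ.filter fun i => Equiv.swap j k (σ i) = i) =
          (S.erase k).erase j := by
        ext i
        simp only [hS, Finset.mem_filter, Finset.mem_univ, true_and, Finset.mem_erase]
        have := σ.injective.eq_iff (a := i) (b := j)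
        have := σ.injective.eq_iff (a := i) (b := k)
        rw [Equiv.swap_apply_def]
        grind
      rw [hGs j hjk, hfix]
      simp only [c, hk, if_neg hjk, if_true]
      by_cases hj : σ j = j
      · have hjS : j ∈ S := by simp [hS, hj]
        rw [if_pos hj, if_pos (Finset.mem_erase.2 ⟨hjk, hjS⟩), if_neg (by simpa using hjS)]
        simp only [mul_zero, add_zero, mul_neg, mul_smul_comm, mul_assoc]
      · have hjS : j ∉ S := by simp [hS, hj]
        simp only [Finset.mem_erase, hj, hjS, Finset.mem_compl,
          Finset.erase_eq_of_notMem (show j ∉ S.erase k by simp [hjS])]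
        simp only [not_false_eq_true, and_false, if_true, if_false,
          zero_add, mul_neg, mul_smul_comm, mul_assoc]
    · have hkS : σ k ∉ S := by simp [hS, hk]
      rw [hF.bracket_of_notMem h S hkS]
      have : ∑ j, c σ j * G (Equiv.swap j (σ k) * σ) = (Equiv.Perm.sign σ : ℤ) •
          ((∑ i ∈ S, a i * F (S.erase i) * W (Equiv.swap i (σ k))) * W σ) := by
        rw [← Finset.sum_subset (Finset.subset_univ S), Finset.sum_mul, Finset.smul_sum]
        · refine Finset.sum_congr rfl fun j hj => ?_
          have hjS : σ j = j := by simpa [hS] using hj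
          have hjk : j ≠ σ k := fun e => hkS (e ▸ hj)
          have hfix : (Finset.univ.filter fun i => Equiv.swap j (σ k) (σ i) = i) = S.erase j := by
            ext i
            simp only [hS, Finset.mem_filter, Finset.mem_univ, true_and, Finset.mem_erase]
            have := σ.injective.eq_iff (a := i) (b := j)
            have := σ.injective.eq_iff (a := i) (b := k)
            rw [Equiv.swap_apply_def]
            grind
          rw [hGs j hjk, hfix]
          simp only [c, if_neg hjk, if_neg hk, if_pos hjS]
          rw [mul_neg, mul_smul_comm, ← smul_neg]
          congr 1
          noncomm_ring
        · intro j _ hj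
          have hjS : ¬ σ j = j := by simpa [hS] using hj
          simp [c, hk, hjS]
      rw [this, mul_smul_comm, ← smul_add]
      congr 1
      noncomm_ring
  have reindex : ∑ σ, ∑ j, c σ j * G (Equiv.swap j (σ k) * σ) =
      ∑ ρ, ∑ l, c (Equiv.swap l (ρ k) * ρ) (ρ k) * G ρ := by
    rw [← Fintype.sum_prod_type', ← Fintype.sum_prod_type']
    let f : Equiv.Perm (Fin N) × Fin N → Equiv.Perm (Fin N) × Fin N :=
      fun x => (Equiv.swap x.2 (x.1 k) * x.1, x.1 k)
    have hf : Function.Involutive f := by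
      rintro ⟨σ, j⟩
      simp [f, Equiv.swap_comm (σ k) j]
    refine Fintype.sum_equiv hf.toPerm _ _ ?_
    rintro ⟨σ, j⟩
    simp [f, Equiv.swap_comm (σ k) j]
  have coeff : ∀ ρ : Equiv.Perm (Fin N),
      ∑ l, c (Equiv.swap l (ρ k) * ρ) (ρ k) = a k - a (ρ k) := by
    intro ρ
    by_cases hρ : ρ k = k
    · rw [hρ, sub_self]
      refine Finset.sum_eq_zero fun l _ => ?_
      by_cases hl : l = k
      · simp [c, hρ, hl]
      · simp [c, hρ, hl, Ne.symm hl]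
    have hne : ρ (ρ k) ≠ ρ k := fun e => hρ (ρ.injective e)
    have hc : ∀ l, c (Equiv.swap l (ρ k) * ρ) (ρ k) =
        (if l = k then (if ρ (ρ k) = k then a k - a (ρ k) else a k) else 0) +
          (if l = ρ (ρ k) then (if ρ (ρ k) = k then 0 else - a (ρ k)) else 0) := by
      intro l
      simp only [c, Equiv.Perm.coe_mul, Function.comp_apply, Equiv.swap_apply_right]
      by_cases hl : l = ρ k
      · subst hl
        simp [hρ, hne.symm]
      have hs : Equiv.swap l (ρ k) (ρ (ρ k)) = ρ k ↔ ρ (ρ k) = l := by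
        rw [Equiv.swap_apply_def]
        grind
      rw [if_neg (Ne.symm hl)]
      simp only [hs]
      grind
    simp only [hc, Finset.sum_add_distrib, Finset.sum_ite_eq', Finset.mem_univ, if_true]
    split_ifs
    · simp
    · abel
  rw [Finset.sum_mul, Finset.mul_sum, ← sub_eq_zero, ← Finset.sum_sub_distrib]
  change ∑ σ, (G σ * a k - a k * G σ) = 0
  simp only [key]
  rw [Finset.sum_add_distrib, reindex, ← Finset.sum_add_distrib]
  refine Finset.sum_eq_zero fun ρ _ => ?_
  rw [← Finset.sum_mul, coeff]
  noncomm_ring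

lemma bracket_commute_of_neg {x y z : A}
    (h : (-x * -y - -y * -x) * -z = -z * (-x * -y - -y * -x)) :
    (x * y - y * x) * z = z * (x * y - y * x) := by
  simpa using h

end NormalOrdered

section Operators

variable {N : ℕ}

/-- The permutation `σ` acting on the variables `z` only. -/
def permZ (N : ℕ) (σ : Equiv.Perm (Fin N)) : Rzl N →ₐ[ℂ] Rzl N := rename (Sum.map σ id)

/-- The action of `S_N` on `ℂ[z,λ]` by simultaneous permutations. -/
def permRep (N : ℕ) : Equiv.Perm (Fin N) →* Module.End ℂ (Rzl N) where
  toFun := permOp N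
  map_one' := by
    refine LinearMap.ext fun p => ?_
    change rename _ p = p
    convert rename_id_apply p
    ext x; cases x <;> rfl
  map_mul' σ τ := by
    refine LinearMap.ext fun p => ?_
    change rename _ p = rename _ (rename _ p)
    rw [rename_rename]
    congr 2
    ext x; cases x <;> rfl

lemma permRep_apply (σ : Equiv.Perm (Fin N)) (p : Rzl N) :
    permRep N σ p = rename (Sum.map σ σ) p := rfl

lemma sL_apply (i j : Fin N) (p : Rzl N) :
    sL N i j p = rename (Sum.map id (Equiv.swap i j)) p := rfl

lemma sZ_apply (i j : Fin N) (p : Rzl N) : sZ N i j p = permZ N (Equiv.swap i j) p := rfl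

lemma mulP_apply (p q : Rzl N) : mulP N p q = p * q := rfl

@[simp] lemma permZ_inl (σ : Equiv.Perm (Fin N)) (i : Fin N) :
    permZ N σ (X (Sum.inl i)) = X (Sum.inl (σ i)) := by simp [permZ]

@[simp] lemma permZ_inr (σ : Equiv.Perm (Fin N)) (i : Fin N) :
    permZ N σ (X (Sum.inr i)) = X (Sum.inr i) := by simp [permZ]

lemma permZ_mul_apply (σ τ : Equiv.Perm (Fin N)) (p : Rzl N) :
    permZ N (σ * τ) p = permZ N σ (permZ N τ p) := by
  simp only [permZ]
  rw [rename_rename]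
  congr 2
  ext x; cases x <;> rfl

@[simp] lemma permZ_one_apply (p : Rzl N) : permZ N 1 p = p := by
  convert rename_id_apply p
  simp only [permZ]
  congr 1
  ext x; cases x <;> rfl

lemma permZ_sL (i j : Fin N) (p : Rzl N) :
    permZ N (Equiv.swap i j) (sL N i j p) = permRep N (Equiv.swap i j) p := by
  rw [permRep_apply, sL_apply, permZ, rename_rename]
  congr 2
  ext x; cases x <;> rfl

lemma rename_sL (σ : Equiv.Perm (Fin N)) (i j : Fin N) (p : Rzl N) :
    rename (Sum.map σ σ) (sL N i j p) = sL N (σ i) (σ j) (rename (Sum.map σ σ) p) := by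
  rw [sL_apply, sL_apply, rename_rename, rename_rename]
  congr 2
  ext x; cases x <;> simp [Equiv.swap_apply_def, apply_ite σ]

lemma rename_permZ (σ τ : Equiv.Perm (Fin N)) (p : Rzl N) :
    rename (Sum.map σ σ) (permZ N τ p) = permZ N (σ * τ * σ⁻¹) (rename (Sum.map σ σ) p) := by
  rw [permZ, permZ, rename_rename, rename_rename]
  congr 2
  ext x; cases x <;> simp

lemma X_inr_sub_ne_zero {i j : Fin N} (h : i ≠ j) :
    (X (Sum.inr i) - X (Sum.inr j) : Rzl N) ≠ 0 := by
  rw [sub_ne_zero]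
  exact fun e => h (Sum.inr_injective (X_injective e))

/-- Operators commuting with the `λ_k` are determined by their values on `ℂ[z]`. -/
lemma eq_of_commute_of_eqOn {A B : Module.End ℂ (Rzl N)}
    (hA : ∀ k, A * mulP N (X (Sum.inr k)) = mulP N (X (Sum.inr k)) * A)
    (hB : ∀ k, B * mulP N (X (Sum.inr k)) = mulP N (X (Sum.inr k)) * B)
    (h : ∀ p : MvPolynomial (Fin N) ℂ, A (rename Sum.inl p) = B (rename Sum.inl p)) :
    A = B := by
  have hpow : ∀ {A : Module.End ℂ (Rzl N)}
      (_ : ∀ k, A * mulP N (X (Sum.inr k)) = mulP N (X (Sum.inr k)) * A)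
      (s : Fin N →₀ ℕ) (q : Rzl N),
      A ((∏ i, X (Sum.inr i) ^ s i) * q) = (∏ i, X (Sum.inr i) ^ s i) * A q := by
    intro A hA s
    have : ∀ T : Finset (Fin N), ∀ q : Rzl N,
        A ((∏ i ∈ T, X (Sum.inr i) ^ s i) * q) = (∏ i ∈ T, X (Sum.inr i) ^ s i) * A q := by
      intro T
      have hp : ∀ k n (q : Rzl N), A (X (Sum.inr k) ^ n * q) = X (Sum.inr k) ^ n * A q := by
        intro k n
        induction n with
        | zero => simp
        | succ n ih =>
          intro q
          rw [pow_succ, mul_assoc, ih, mul_assoc]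
          congr 1
          exact LinearMap.congr_fun (hA k) q
      induction T using Finset.induction_on with
      | empty => simp
      | insert k T hk ih =>
        intro q
        rw [Finset.prod_insert hk, mul_assoc, hp, ih, mul_assoc]
    exact this _
  refine LinearMap.ext fun p => ?_
  induction p using MvPolynomial.induction_on' with
  | add p q hp hq => rw [map_add, map_add, hp, hq]
  | monomial s c =>
    have : (monomial s c : Rzl N) = (∏ i, X (Sum.inr i) ^
        (s.comapDomain Sum.inr Sum.inr_injective.injOn) i) *
          rename Sum.inl (C c * ∏ i, X i ^ s (Sum.inl i)) := by
      rw [monomial_eq, Finsupp.prod_fintype _ _ (by simp), Fintype.prod_sum_type]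
      simp only [map_mul, map_prod, map_pow, rename_X, rename_C, Finsupp.comapDomain_apply]
      ring
    rw [this, hpow hA, hpow hB, h]

/-- The operators `K` are the given Dunkl-type operators. -/
structure IsDunkl (D : Fin N → Fin N → Rzl N → Rzl N) (K : Fin N → Module.End ℂ (Rzl N)) :
    Prop where
  diff : ∀ i j : Fin N, i ≠ j → ∀ p : Rzl N,
      (X (Sum.inr i) - X (Sum.inr j)) * D i j p = p - sL N i j p
  apply_eq : ∀ (i : Fin N) (p : Rzl N),
      K i p = X (Sum.inl i) * p + ∑ j ∈ Finset.univ.erase i, sZ N i j (D i j p)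

variable {D : Fin N → Fin N → Rzl N → Rzl N} {K : Fin N → Module.End ℂ (Rzl N)}

lemma IsDunkl.diff_eq (h : IsDunkl D K) {i j : Fin N} (hij : i ≠ j) {p q : Rzl N}
    (hq : (X (Sum.inr i) - X (Sum.inr j)) * q = p - sL N i j p) : D i j p = q :=
  mul_left_cancel₀ (X_inr_sub_ne_zero hij) ((h.diff i j hij p).trans hq.symm)

lemma IsDunkl.apply_rename_inl (h : IsDunkl D K) (i : Fin N) (p : MvPolynomial (Fin N) ℂ) :
    K i (rename Sum.inl p) = rename Sum.inl (X i * p) := by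
  rw [h.apply_eq, Finset.sum_eq_zero, add_zero, map_mul, rename_X]
  intro j hj
  rw [h.diff_eq (q := 0) (Ne.symm (Finset.ne_of_mem_erase hj)), map_zero]
  rw [sL_apply, rename_rename, mul_zero, eq_comm, sub_eq_zero]
  rfl

lemma IsDunkl.perm_mul (h : IsDunkl D K) (σ : Equiv.Perm (Fin N)) (i : Fin N) :
    permRep N σ * K i = K (σ i) * permRep N σ := by
  refine LinearMap.ext fun p => ?_
  simp only [Module.End.mul_apply, permRep_apply]
  rw [h.apply_eq, h.apply_eq, map_add, map_mul, rename_X, map_sum]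
  congr 1
  refine Finset.sum_equiv σ (by simp) fun j hj => ?_
  have hij : i ≠ j := Ne.symm (Finset.ne_of_mem_erase hj)
  rw [sZ_apply, rename_permZ, sZ_apply]
  congr 1
  · congr 1
    rw [Equiv.swap_apply_apply]
  · symm
    refine h.diff_eq (σ.injective.ne hij) ?_
    have := congrArg (rename (Sum.map σ σ)) (h.diff i j hij p)
    rw [map_sub, rename_sL] at this
    rw [← this]
    simp

lemma IsDunkl.cross (h : IsDunkl D K) {i j : Fin N} (hij : i ≠ j) :
    K i * mulP N (X (Sum.inr j)) = mulP N (X (Sum.inr j)) * K i - permRep N (Equiv.swap i j) := by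
  refine LinearMap.ext fun p => ?_
  simp only [Module.End.mul_apply, LinearMap.sub_apply, mulP_apply]
  have hj : j ∈ Finset.univ.erase i := by simp [hij.symm]
  rw [h.apply_eq, h.apply_eq, ← Finset.add_sum_erase _ _ hj, ← Finset.add_sum_erase _ _ hj]
  rw [h.diff_eq hij (q := X (Sum.inr j) * D i j p - sL N i j p)]
  · rw [Finset.sum_congr rfl (g := fun l => X (Sum.inr j) * sZ N i l (D i l p))]
    · simp only [sZ_apply, map_sub, map_mul, permZ_inr, permZ_sL, ← Finset.mul_sum]
      ring
    · intro l hl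
      have hlj := Finset.ne_of_mem_erase hl
      have hli := Finset.ne_of_mem_erase (Finset.mem_of_mem_erase hl)
      rw [h.diff_eq hli.symm (q := X (Sum.inr j) * D i l p)]
      · simp [sZ_apply]
      · rw [mul_left_comm, h.diff i l hli.symm, map_mul, sL_apply i l (X _), rename_X, Sum.map_inr,
          Equiv.swap_apply_of_ne_of_ne hij.symm hlj.symm, mul_sub]
  · rw [mul_sub, mul_left_comm, h.diff i j hij, map_mul, sL_apply i j (X _), rename_X, Sum.map_inr,
      Equiv.swap_apply_right]
    ring

lemma IsDunkl.cross_self (h : IsDunkl D K) (i : Fin N) :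
    K i * mulP N (X (Sum.inr i)) = mulP N (X (Sum.inr i)) * K i +
      ∑ j ∈ Finset.univ.erase i, permRep N (Equiv.swap i j) := by
  refine LinearMap.ext fun p => ?_
  simp only [Module.End.mul_apply, LinearMap.add_apply, mulP_apply, LinearMap.sum_apply]
  rw [h.apply_eq, h.apply_eq, mul_add, add_assoc, Finset.mul_sum, ← Finset.sum_add_distrib,
    mul_left_comm]
  congr 1
  refine Finset.sum_congr rfl fun j hj => ?_
  have hij := (Finset.ne_of_mem_erase hj).symm
  rw [h.diff_eq hij (q := X (Sum.inr i) * D i j p + sL N i j p)]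
  · simp only [sZ_apply, map_add, map_mul, permZ_inr, permZ_sL]
  · rw [mul_add, mul_left_comm, h.diff i j hij, map_mul, sL_apply i j (X _), rename_X, Sum.map_inr,
      Equiv.swap_apply_left]
    ring

lemma mulP_mul (p q : Rzl N) : mulP N (p * q) = mulP N p * mulP N q := by
  refine LinearMap.ext fun r => ?_; simp [mulP_apply, mul_assoc]

lemma mulP_sub (p q : Rzl N) : mulP N (p - q) = mulP N p - mulP N q := by
  refine LinearMap.ext fun r => ?_; simp [mulP_apply, sub_mul]

lemma mulP_C (v : ℂ) : mulP N (C v) = v • 1 := by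
  refine LinearMap.ext fun r => ?_; simp [mulP_apply, C_mul']

lemma perm_mul_mulP (σ : Equiv.Perm (Fin N)) (p : Rzl N) :
    permRep N σ * mulP N p = mulP N (rename (Sum.map σ σ) p) * permRep N σ := by
  refine LinearMap.ext fun q => ?_; simp [mulP_apply, permRep_apply]

lemma IsDunkl.relations (h : IsDunkl D K) (u v : ℂ) :
    CherednikRelations (fun i => mulP N (C v - X (Sum.inr i)))
      (fun i => u • (1 : Module.End ℂ (Rzl N)) - K i) (permRep N) where
  commute_left i j := by rw [← mulP_mul, ← mulP_mul, mul_comm]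
  perm_left σ i := by rw [perm_mul_mulP]; simp
  perm_right σ i := by rw [mul_sub, h.perm_mul]; simp [sub_mul]
  cross i j hij := by
    have := h.cross hij
    simp only [mulP_sub, mulP_C, sub_mul, mul_sub, this, smul_mul_assoc, mul_smul_comm, one_mul,
      mul_one, smul_sub, smul_comm u v]
    abel
  cross_self i := by
    have := h.cross_self i
    simp only [mulP_sub, mulP_C, sub_mul, mul_sub, this, smul_mul_assoc, mul_smul_comm, one_mul,
      mul_one, smul_sub, smul_comm u v]
    abel

lemma IsDunkl.commute (h : IsDunkl D K) (i j : Fin N) : K i * K j = K j * K i := by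
  have hr : ∀ k, (K i * K j - K j * K i) * mulP N (X (Sum.inr k)) =
      mulP N (X (Sum.inr k)) * (K i * K j - K j * K i) := by
    intro k
    have := (h.relations 0 0).bracket_commute i j k
    simp only [mulP_sub, mulP_C, zero_smul, zero_sub] at this
    exact bracket_commute_of_neg this
  rw [← sub_eq_zero]
  refine eq_of_commute_of_eqOn hr (by simp) fun p => ?_
  simp only [LinearMap.sub_apply, Module.End.mul_apply, h.apply_rename_inl, LinearMap.zero_apply,
    mul_left_comm, sub_self]

end Operators

section CommutativeForm

variable {N : ℕ}

lemma ordProd_insert {f : Fin N → Module.End ℂ (Rzl N)} (hf : ∀ i j, Commute (f i) (f j))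
    {k : Fin N} {S : Finset (Fin N)} (hk : k ∉ S) :
    ordProd (insert k S) f = ordProd S f * f k := by
  have hp : ∀ T : Finset (Fin N), (T : Set (Fin N)).Pairwise (Function.onFun Commute f) :=
    fun T i _ j _ _ => hf i j
  have h : ∀ T : Finset (Fin N), ordProd T f = T.noncommProd f (hp T) := by
    intro T
    have := Finset.noncommProd_toFinset (T.sort (· ≤ ·)) f
      (fun i _ j _ _ => hf i j) (T.sort_nodup _)
    simp only [Finset.sort_toFinset] at this
    exact this.symm
  rw [h, h]
  exact Finset.noncommProd_insert_of_notMem' _ _ _ _ hk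

@[simp] lemma ordProd_empty (f : Fin N → Module.End ℂ (Rzl N)) : ordProd ∅ f = 1 := by
  simp [ordProd]

/-- The normally ordered form of the product `Π_{i∈S} (1 - a_i κ_i)`. -/
def normalSum (a : Fin N → Rzl N) (κ : Fin N → Module.End ℂ (Rzl N)) (S : Finset (Fin N)) :
    Module.End ℂ (Rzl N) :=
  ∑ T ∈ S.powerset, ((-1 : ℤ) ^ T.card) • (mulP N (∏ i ∈ T, a i) * ordProd T κ)

lemma neg_pow_succ_smul_mul {A : Type*} [Ring A] (n : ℕ) (x y z t : A) :
    ((-1 : ℤ) ^ (n + 1)) • (x * y * (z * t)) = -(x * (((-1 : ℤ) ^ n) • (y * z)) * t) := by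
  rw [pow_succ, mul_neg_one, neg_smul, mul_smul_comm, smul_mul_assoc]
  noncomm_ring

lemma normalSum_insert {a : Fin N → Rzl N} {κ : Fin N → Module.End ℂ (Rzl N)}
    (hκ : ∀ i j, Commute (κ i) (κ j)) (S : Finset (Fin N)) (k : Fin N) (hk : k ∉ S) :
    normalSum a κ (insert k S) = normalSum a κ S - mulP N (a k) * normalSum a κ S * κ k := by
  rw [normalSum, Finset.sum_powerset_insert hk, sub_eq_add_neg, normalSum]
  congr 1
  rw [Finset.mul_sum, Finset.sum_mul, ← Finset.sum_neg_distrib]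
  refine Finset.sum_congr rfl fun T hT => ?_
  have hkT : k ∉ T := fun h => hk (Finset.mem_powerset.1 hT h)
  rw [Finset.card_insert_of_notMem hkT, Finset.prod_insert hkT, ordProd_insert hκ hkT, mulP_mul]
  exact neg_pow_succ_smul_mul _ _ _ _ _

lemma normalSum_isNormalOrdered {a : Fin N → Rzl N} {κ : Fin N → Module.End ℂ (Rzl N)}
    (hκ : ∀ i j, Commute (κ i) (κ j)) :
    IsNormalOrdered (fun i => mulP N (a i)) κ (normalSum a κ) where
  empty_eq := by
    refine LinearMap.ext fun p => ?_
    simp [normalSum, mulP_apply]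
  insert_eq S k hk := normalSum_insert hκ S k hk

lemma Puv_eq (K : Fin N → Module.End ℂ (Rzl N)) (u v : ℂ) :
    Puv K u v = ((-1 : ℤ) ^ N) • ∑ σ : Equiv.Perm (Fin N), (Equiv.Perm.sign σ : ℤ) •
      (normalSum (fun i => C v - X (Sum.inr i)) (fun i => u • (1 : Module.End ℂ (Rzl N)) - K i)
        (Finset.univ.filter fun i => σ i = i) * permRep N σ) := rfl

/-- The factor of the universal Bethe polynomial attached to the fixed points of `σ`. -/
def fixProd (u v : ℂ) (σ : Equiv.Perm (Fin N)) : Rzl N :=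
  ∏ i ∈ Finset.univ.filter (fun i => σ i = i),
    (1 - (C v - X (Sum.inr i)) * (C u - X (Sum.inl i)))

/-- The universal central polynomial written with the commuting operators `z_i`, `λ_i` and
the permutations of the variables `z` only. -/
def gaudinOp (N : ℕ) (u v : ℂ) : Module.End ℂ (Rzl N) :=
  ((-1 : ℤ) ^ N) • ∑ σ : Equiv.Perm (Fin N), (Equiv.Perm.sign σ : ℤ) •
    (mulP N (fixProd u v σ) * (permZ N σ).toLinearMap)

lemma gaudinOp_apply (u v : ℂ) (p : Rzl N) :
    gaudinOp N u v p = ((-1 : ℤ) ^ N) • ∑ σ : Equiv.Perm (Fin N), (Equiv.Perm.sign σ : ℤ) •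
      (fixProd u v σ * permZ N σ p) := by
  rw [gaudinOp, LinearMap.smul_apply, LinearMap.sum_apply]
  rfl

variable {D : Fin N → Fin N → Rzl N → Rzl N} {K : Fin N → Module.End ℂ (Rzl N)}

lemma IsDunkl.commute_shift (h : IsDunkl D K) (u : ℂ) (i j : Fin N) :
    Commute (u • (1 : Module.End ℂ (Rzl N)) - K i) (u • (1 : Module.End ℂ (Rzl N)) - K j) := by
  have : Commute (K i) (K j) := h.commute i j
  exact ((Commute.one_left _).smul_left u |>.sub_right
    ((Commute.one_left _).smul_left u)).sub_left
      (((Commute.one_right _).smul_right u).sub_right this)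

lemma commute_of_commute_C_sub {A : Module.End ℂ (Rzl N)} {v : ℂ} {k : Fin N}
    (h : A * mulP N (C v - X (Sum.inr k)) = mulP N (C v - X (Sum.inr k)) * A) :
    A * mulP N (X (Sum.inr k)) = mulP N (X (Sum.inr k)) * A := by
  rw [mulP_sub, mulP_C, mul_sub, sub_mul, mul_smul_comm, smul_mul_assoc, mul_one, one_mul] at h
  exact sub_right_injective h

lemma IsDunkl.Puv_commute (h : IsDunkl D K) (u v : ℂ) (k : Fin N) :
    Puv K u v * mulP N (X (Sum.inr k)) = mulP N (X (Sum.inr k)) * Puv K u v := by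
  refine commute_of_commute_C_sub (v := v) ?_
  have := (normalSum_isNormalOrdered (a := fun i => C v - X (Sum.inr i))
    (h.commute_shift u)).sum_commute (h.relations u v) k
  rw [Puv_eq, smul_mul_assoc, mul_smul_comm, this]

lemma gaudinOp_commute_inr (u v : ℂ) (k : Fin N) :
    gaudinOp N u v * mulP N (X (Sum.inr k)) = mulP N (X (Sum.inr k)) * gaudinOp N u v := by
  refine LinearMap.ext fun p => ?_
  simp only [Module.End.mul_apply, mulP_apply, gaudinOp_apply, map_mul, permZ_inr,
    mul_smul_comm, Finset.mul_sum, mul_left_comm]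

lemma IsDunkl.normalSum_rename (h : IsDunkl D K) (u v : ℂ) (S : Finset (Fin N))
    (p : MvPolynomial (Fin N) ℂ) :
    normalSum (fun i => C v - X (Sum.inr i)) (fun i => u • (1 : Module.End ℂ (Rzl N)) - K i) S
      (rename Sum.inl p) =
      (∏ i ∈ S, (1 - (C v - X (Sum.inr i)) * (C u - X (Sum.inl i)))) * rename Sum.inl p := by
  have hn := normalSum_isNormalOrdered (a := fun i => C v - X (Sum.inr i)) (h.commute_shift u)
  induction S using Finset.induction_on generalizing p with
  | empty => simp [hn.empty_eq]
  | insert k S hk ih =>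
    have hs : (u • (1 : Module.End ℂ (Rzl N)) - K k) (rename Sum.inl p) =
        rename Sum.inl ((C u - X k) * p) := by
      simp [h.apply_rename_inl, sub_mul, C_mul']
    rw [hn.insert_eq S k hk, LinearMap.sub_apply, Module.End.mul_apply, Module.End.mul_apply, hs,
      ih, ih, Finset.prod_insert hk, mulP_apply]
    simp only [map_mul, map_sub, rename_C, rename_X]
    ring

/-- The universal central polynomial takes a commutative form. -/
lemma IsDunkl.Puv_eq_gaudinOp (h : IsDunkl D K) (u v : ℂ) : Puv K u v = gaudinOp N u v := by
  refine eq_of_commute_of_eqOn (h.Puv_commute u v) (gaudinOp_commute_inr u v) fun p => ?_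
  rw [Puv_eq, gaudinOp_apply, LinearMap.smul_apply, LinearMap.sum_apply]
  congr 1
  refine Finset.sum_congr rfl fun σ _ => ?_
  rw [LinearMap.smul_apply, Module.End.mul_apply]
  have h1 : permRep N σ (rename Sum.inl p) = rename Sum.inl (rename σ p) := by
    rw [permRep_apply, rename_rename, rename_rename]; rfl
  have h2 : permZ N σ (rename Sum.inl p) = rename Sum.inl (rename σ p) := by
    rw [permZ, rename_rename, rename_rename]; rfl
  rw [h1, h2, h.normalSum_rename, fixProd]

end CommutativeForm

section Central

variable {N : ℕ} {D : Fin N → Fin N → Rzl N → Rzl N} {K : Fin N → Module.End ℂ (Rzl N)}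

lemma rename_fixProd (u v : ℂ) (ρ σ : Equiv.Perm (Fin N)) :
    rename (Sum.map ρ ρ) (fixProd u v σ) = fixProd u v (ρ * σ * ρ⁻¹) := by
  simp only [fixProd, map_prod, map_sub, map_mul, map_one, rename_C, rename_X, Sum.map_inl,
    Sum.map_inr]
  refine Finset.prod_equiv ρ (fun i => ?_) fun i _ => rfl
  rw [Finset.mem_filter, Finset.mem_filter]
  simp

lemma sum_perm_conj {M : Type*} [AddCommMonoid M] (ρ : Equiv.Perm (Fin N))
    (f : Equiv.Perm (Fin N) → M) : ∑ σ, f (ρ * σ * ρ⁻¹) = ∑ σ, f σ :=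
  Fintype.sum_equiv (MulAut.conj ρ).toEquiv _ _ fun _ => rfl

lemma sum_perm_mul_right {M : Type*} [AddCommMonoid M] (ρ : Equiv.Perm (Fin N))
    (f : Equiv.Perm (Fin N) → M) : ∑ σ, f (σ * ρ) = ∑ σ, f σ :=
  Fintype.sum_equiv (Equiv.mulRight ρ) _ _ fun _ => rfl

lemma sum_perm_mul_left {M : Type*} [AddCommMonoid M] (ρ : Equiv.Perm (Fin N))
    (f : Equiv.Perm (Fin N) → M) : ∑ σ, f (ρ * σ) = ∑ σ, f σ :=
  Fintype.sum_equiv (Equiv.mulLeft ρ) _ _ fun _ => rfl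

lemma gaudinOp_perm (u v : ℂ) (ρ : Equiv.Perm (Fin N)) :
    gaudinOp N u v * permRep N ρ = permRep N ρ * gaudinOp N u v := by
  refine LinearMap.ext fun p => ?_
  rw [Module.End.mul_apply, Module.End.mul_apply, gaudinOp_apply, gaudinOp_apply, permRep_apply,
    permRep_apply, map_zsmul, map_sum, ← sum_perm_conj ρ]
  congr 1
  refine Finset.sum_congr rfl fun σ _ => ?_
  have hs : Equiv.Perm.sign (ρ * σ * ρ⁻¹) = Equiv.Perm.sign σ := by
    rw [Equiv.Perm.sign_mul, Equiv.Perm.sign_mul, Equiv.Perm.sign_inv, mul_right_comm,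
      Int.units_mul_self, one_mul]
  rw [hs, map_zsmul, map_mul (rename (Sum.map ρ ρ)), rename_fixProd, rename_permZ]

lemma fixProd_split (u v : ℂ) (σ : Equiv.Perm (Fin N)) {k j : Fin N} (hkj : k ≠ j) :
    fixProd u v σ =
      (if σ k = k then 1 - (C v - X (Sum.inr k)) * (C u - X (Sum.inl k)) else 1) *
      ((if σ j = j then 1 - (C v - X (Sum.inr j)) * (C u - X (Sum.inl j)) else 1) *
      ∏ i ∈ (Finset.univ.erase k).erase j,
        if σ i = i then 1 - (C v - X (Sum.inr i)) * (C u - X (Sum.inl i)) else 1) := by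
  have hj : j ∈ Finset.univ.erase k := by simp [hkj.symm]
  rw [fixProd, Finset.prod_filter, ← Finset.mul_prod_erase _ _ (Finset.mem_univ k),
    ← Finset.mul_prod_erase _ _ hj]

lemma fixProd_swap_sub (u v : ℂ) (ρ : Equiv.Perm (Fin N)) {k j : Fin N} (hkj : k ≠ j) :
    fixProd u v (ρ * Equiv.swap k j) -
      permZ N (Equiv.swap k j) (fixProd u v (Equiv.swap k j * ρ)) =
    (X (Sum.inr k) - X (Sum.inr j)) * (fixProd u v ρ *
      ((if ρ j = k then C u - X (Sum.inl k) else 0) -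
        (if ρ k = j then C u - X (Sum.inl j) else 0))) := by
  have hprod : ∏ i ∈ (Finset.univ.erase k).erase j,
        (if (ρ * Equiv.swap k j) i = i then
          1 - (C v - X (Sum.inr i)) * (C u - X (Sum.inl i)) else (1 : Rzl N)) =
      ∏ i ∈ (Finset.univ.erase k).erase j,
        if ρ i = i then 1 - (C v - X (Sum.inr i)) * (C u - X (Sum.inl i)) else 1 := by
    refine Finset.prod_congr rfl fun i hi => ?_
    have hij := Finset.ne_of_mem_erase hi
    have hik := Finset.ne_of_mem_erase (Finset.mem_of_mem_erase hi)
    rw [Equiv.Perm.mul_apply, Equiv.swap_apply_of_ne_of_ne hik hij]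
  have hprod' : permZ N (Equiv.swap k j) (∏ i ∈ (Finset.univ.erase k).erase j,
        (if (Equiv.swap k j * ρ) i = i then
          1 - (C v - X (Sum.inr i)) * (C u - X (Sum.inl i)) else (1 : Rzl N))) =
      ∏ i ∈ (Finset.univ.erase k).erase j,
        if ρ i = i then 1 - (C v - X (Sum.inr i)) * (C u - X (Sum.inl i)) else 1 := by
    rw [map_prod]
    refine Finset.prod_congr rfl fun i hi => ?_
    have hij := Finset.ne_of_mem_erase hi
    have hik := Finset.ne_of_mem_erase (Finset.mem_of_mem_erase hi)
    have hs : (Equiv.swap k j * ρ) i = i ↔ ρ i = i := by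
      rw [Equiv.Perm.mul_apply, Equiv.swap_apply_eq_iff, Equiv.swap_apply_of_ne_of_ne hik hij]
    simp only [hs]
    split_ifs
    · simp [Equiv.swap_apply_of_ne_of_ne hik hij, permZ]
    · simp
  have h1 : (Equiv.swap k j * ρ) k = k ↔ ρ k = j := by
    rw [Equiv.Perm.mul_apply, Equiv.swap_apply_eq_iff, Equiv.swap_apply_left]
  have h2 : (Equiv.swap k j * ρ) j = j ↔ ρ j = k := by
    rw [Equiv.Perm.mul_apply, Equiv.swap_apply_eq_iff, Equiv.swap_apply_right]
  have h3 : (ρ * Equiv.swap k j) k = k ↔ ρ j = k := by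
    rw [Equiv.Perm.mul_apply, Equiv.swap_apply_left]
  have h4 : (ρ * Equiv.swap k j) j = j ↔ ρ k = j := by
    rw [Equiv.Perm.mul_apply, Equiv.swap_apply_right]
  rw [fixProd_split u v _ hkj, fixProd_split u v (Equiv.swap k j * ρ) hkj, map_mul, map_mul,
    hprod', hprod, fixProd_split u v ρ hkj]
  simp only [h1, h2, h3, h4]
  set E := ∏ i ∈ (Finset.univ.erase k).erase j,
        if ρ i = i then 1 - (C v - X (Sum.inr i)) * (C u - X (Sum.inl i)) else (1 : Rzl N)
  have hC : ∀ w : ℂ, permZ N (Equiv.swap k j) (C w) = C w := fun w => by simp [permZ]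
  have h5 : ρ j = k → ρ j ≠ j ∧ ρ k ≠ k := fun e =>
    ⟨e ▸ hkj, fun e' => hkj (ρ.injective (e'.trans e.symm))⟩
  have h6 : ρ k = j → ρ j ≠ j ∧ ρ k ≠ k := fun e =>
    ⟨fun e' => hkj (ρ.injective (e.trans e'.symm)), fun e' => hkj (e'.symm.trans e)⟩
  by_cases hj : ρ j = k
  · rw [if_pos hj, if_pos hj, if_pos hj, if_neg (h5 hj).1, if_neg (h5 hj).2]
    by_cases hk : ρ k = j
    · rw [if_pos hk, if_pos hk, if_pos hk]
      simp [hC]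
      ring
    · rw [if_neg hk, if_neg hk, if_neg hk]
      simp [hC]
      ring
  · rw [if_neg hj, if_neg hj, if_neg hj]
    by_cases hk : ρ k = j
    · rw [if_pos hk, if_pos hk, if_pos hk, if_neg (h6 hk).1, if_neg (h6 hk).2]
      simp [hC]
      ring
    · rw [if_neg hk, if_neg hk, if_neg hk]
      simp

lemma smul_sub_smul_eq_neg {M : Type*} [AddCommGroup M] (n : ℤ) {a b x y : M}
    (h : a - b = y - x) : n • a - n • b = -(n • (x - y)) := by
  rw [← smul_sub, h, ← smul_neg, neg_sub]

lemma gaudinOp_permZ_swap (u v : ℂ) {k j : Fin N} (hkj : k ≠ j) (p : Rzl N) :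
    gaudinOp N u v (permZ N (Equiv.swap k j) p) - permZ N (Equiv.swap k j) (gaudinOp N u v p) =
      (X (Sum.inr k) - X (Sum.inr j)) *
        -(((-1 : ℤ) ^ N) • ∑ ρ : Equiv.Perm (Fin N), (Equiv.Perm.sign ρ : ℤ) •
          (fixProd u v ρ * ((if ρ j = k then C u - X (Sum.inl k) else 0) -
            (if ρ k = j then C u - X (Sum.inl j) else 0)) * permZ N ρ p)) := by
  have h0 : ∀ ρ : Equiv.Perm (Fin N), (X (Sum.inr k) - X (Sum.inr j)) *
      ((Equiv.Perm.sign ρ : ℤ) •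
          (fixProd u v ρ * ((if ρ j = k then C u - X (Sum.inl k) else 0) -
            (if ρ k = j then C u - X (Sum.inl j) else 0)) * permZ N ρ p)) =
      (Equiv.Perm.sign ρ : ℤ) • (fixProd u v (ρ * Equiv.swap k j) * permZ N ρ p) -
        (Equiv.Perm.sign ρ : ℤ) •
          (permZ N (Equiv.swap k j) (fixProd u v (Equiv.swap k j * ρ)) * permZ N ρ p) := by
    intro ρ
    rw [mul_smul_comm, ← mul_assoc, ← fixProd_swap_sub u v ρ hkj, sub_mul, smul_sub]
  rw [mul_neg, mul_smul_comm, Finset.mul_sum]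
  simp only [h0]
  rw [Finset.sum_sub_distrib]
  rw [gaudinOp_apply, gaudinOp_apply, map_zsmul, map_sum]
  refine smul_sub_smul_eq_neg _ ?_
  have hs : ∀ σ : Equiv.Perm (Fin N), (Equiv.Perm.sign (σ * Equiv.swap k j) : ℤ) =
      -Equiv.Perm.sign σ := fun σ => by rw [Equiv.Perm.sign_mul, Equiv.Perm.sign_swap hkj]; simp
  have hs' : ∀ σ : Equiv.Perm (Fin N), (Equiv.Perm.sign (Equiv.swap k j * σ) : ℤ) =
      -Equiv.Perm.sign σ := fun σ => by rw [Equiv.Perm.sign_mul, Equiv.Perm.sign_swap hkj]; simp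
  have h1 : ∑ σ : Equiv.Perm (Fin N), (Equiv.Perm.sign σ : ℤ) •
      (fixProd u v σ * permZ N σ (permZ N (Equiv.swap k j) p)) =
      -∑ ρ : Equiv.Perm (Fin N), (Equiv.Perm.sign ρ : ℤ) •
        (fixProd u v (ρ * Equiv.swap k j) * permZ N ρ p) := by
    rw [← Finset.sum_neg_distrib, ← sum_perm_mul_right (Equiv.swap k j)]
    refine Finset.sum_congr rfl fun σ _ => ?_
    rw [← permZ_mul_apply, mul_assoc, Equiv.swap_mul_self, mul_one, hs, neg_smul]
  have h2 : ∑ σ : Equiv.Perm (Fin N), permZ N (Equiv.swap k j) ((Equiv.Perm.sign σ : ℤ) •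
      (fixProd u v σ * permZ N σ p)) =
      -∑ ρ : Equiv.Perm (Fin N), (Equiv.Perm.sign ρ : ℤ) •
        (permZ N (Equiv.swap k j) (fixProd u v (Equiv.swap k j * ρ)) * permZ N ρ p) := by
    rw [← Finset.sum_neg_distrib, ← sum_perm_mul_left (Equiv.swap k j)]
    refine Finset.sum_congr rfl fun σ _ => ?_
    rw [map_zsmul, map_mul (permZ N (Equiv.swap k j)), ← permZ_mul_apply, ← mul_assoc,
      Equiv.swap_mul_self, one_mul, hs', neg_smul]
  rw [h1, h2, sub_neg_eq_add, neg_add_eq_sub]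

lemma gaudinOp_X_inl (u v : ℂ) (k : Fin N) (p : Rzl N) :
    gaudinOp N u v (X (Sum.inl k) * p) - X (Sum.inl k) * gaudinOp N u v p =
      ((-1 : ℤ) ^ N) • ∑ ρ : Equiv.Perm (Fin N), (Equiv.Perm.sign ρ : ℤ) •
        (fixProd u v ρ * (X (Sum.inl (ρ k)) - X (Sum.inl k)) * permZ N ρ p) := by
  rw [gaudinOp_apply, gaudinOp_apply, mul_smul_comm, ← smul_sub, Finset.mul_sum,
    ← Finset.sum_sub_distrib]
  congr 1
  refine Finset.sum_congr rfl fun ρ _ => ?_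
  rw [mul_smul_comm, ← smul_sub, map_mul, permZ_inl]
  congr 1
  ring

lemma sum_ite_sub_ite (u : ℂ) (ρ : Equiv.Perm (Fin N)) (k : Fin N) :
    ∑ j ∈ Finset.univ.erase k, ((if ρ j = k then C u - X (Sum.inl k) else (0 : Rzl N)) -
        (if ρ k = j then C u - X (Sum.inl j) else 0)) = X (Sum.inl (ρ k)) - X (Sum.inl k) := by
  rw [Finset.sum_erase]
  · rw [Finset.sum_sub_distrib, Finset.sum_ite_eq, if_pos (Finset.mem_univ _)]
    have : ∀ j, ρ j = k ↔ j = ρ⁻¹ k := fun j => by rw [Equiv.Perm.eq_inv_iff_eq]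
    simp only [this]
    simp
  · split_ifs <;> simp

lemma IsDunkl.gaudinOp_commute (h : IsDunkl D K) (u v : ℂ) (k : Fin N) :
    gaudinOp N u v * K k = K k * gaudinOp N u v := by
  refine LinearMap.ext fun p => ?_
  rw [Module.End.mul_apply, Module.End.mul_apply, ← sub_eq_zero, h.apply_eq, h.apply_eq, map_add,
    map_sum, add_sub_add_comm, ← Finset.sum_sub_distrib, gaudinOp_X_inl]
  have hl : ∀ (i : Fin N) (q : Rzl N),
      gaudinOp N u v (X (Sum.inr i) * q) = X (Sum.inr i) * gaudinOp N u v q :=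
    fun i q => LinearMap.congr_fun (gaudinOp_commute_inr u v i) q
  have key : ∀ j ∈ Finset.univ.erase k,
      gaudinOp N u v (sZ N k j (D k j p)) - sZ N k j (D k j (gaudinOp N u v p)) =
      -(((-1 : ℤ) ^ N) • ∑ ρ : Equiv.Perm (Fin N), (Equiv.Perm.sign ρ : ℤ) •
          (fixProd u v ρ * ((if ρ j = k then C u - X (Sum.inl k) else 0) -
            (if ρ k = j then C u - X (Sum.inl j) else 0)) * permZ N ρ p)) := by
    intro j hj
    have hkj := (Finset.ne_of_mem_erase hj).symm
    refine mul_left_cancel₀ (X_inr_sub_ne_zero hkj) ?_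
    rw [← gaudinOp_permZ_swap u v hkj]
    have hs : ∀ q : Rzl N, (X (Sum.inr k) - X (Sum.inr j)) * sZ N k j (D k j q) =
        permZ N (Equiv.swap k j) q - permRep N (Equiv.swap k j) q := by
      intro q
      rw [← permZ_sL, ← map_sub, ← h.diff k j hkj q, map_mul, map_sub, permZ_inr, permZ_inr,
        sZ_apply]
    have hQ : gaudinOp N u v ((X (Sum.inr k) - X (Sum.inr j)) * sZ N k j (D k j p)) =
        (X (Sum.inr k) - X (Sum.inr j)) * gaudinOp N u v (sZ N k j (D k j p)) := by
      rw [sub_mul, map_sub, hl, hl, sub_mul]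
    rw [mul_sub, ← hQ, hs, hs, map_sub]
    have := LinearMap.congr_fun (gaudinOp_perm u v (Equiv.swap k j)) p
    rw [Module.End.mul_apply, Module.End.mul_apply] at this
    rw [this]
    abel
  rw [Finset.sum_congr rfl key, Finset.sum_neg_distrib, ← Finset.smul_sum, Finset.sum_comm]
  simp only [← Finset.smul_sum, ← Finset.sum_mul, ← Finset.mul_sum, sum_ite_sub_ite]
  rw [add_neg_cancel]

end Central

section Coefficients

variable {V : Type*} [AddCommGroup V] [Module ℂ V] {N : ℕ}

lemma mem_of_sum_pow_smul_mem (W : Submodule ℂ V) (a : Fin (N + 1) → V)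
    (h : ∀ u : ℂ, ∑ i : Fin (N + 1), u ^ (N - (i : ℕ)) • a i ∈ W) (i : Fin (N + 1)) :
    a i ∈ W := by
  rw [← Submodule.Quotient.mk_eq_zero, ← Module.forall_dual_apply_eq_zero_iff ℂ]
  intro f
  have hp : (∑ i : Fin (N + 1), Polynomial.monomial (N - (i : ℕ))
      (f (Submodule.Quotient.mk (a i))) : Polynomial ℂ) = 0 := by
    refine Polynomial.funext fun u => ?_
    rw [Polynomial.eval_finsetSum, Polynomial.eval_zero]
    have := congrArg f ((Submodule.Quotient.mk_eq_zero W).2 (h u))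
    rw [map_zero, ← Submodule.mkQ_apply, map_sum, map_sum] at this
    rw [← this]
    refine Finset.sum_congr rfl fun j _ => ?_
    simp [mul_comm]
  have := congrArg (fun p => Polynomial.coeff p (N - (i : ℕ))) hp
  simp only [Polynomial.finsetSum_coeff, Polynomial.coeff_monomial, Polynomial.coeff_zero] at this
  rw [Finset.sum_eq_single i] at this
  · simpa using this
  · intro j _ hj
    rw [if_neg]
    have := Fin.val_ne_of_ne hj
    omega
  · simp

lemma mem_of_sum_sum_pow_smul_mem (W : Submodule ℂ V) (a : Fin (N + 1) → Fin (N + 1) → V)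
    (h : ∀ u v : ℂ, ∑ i : Fin (N + 1), ∑ j : Fin (N + 1),
      (u ^ (N - (i : ℕ)) * v ^ (N - (j : ℕ))) • a i j ∈ W) (i j : Fin (N + 1)) :
    a i j ∈ W := by
  refine mem_of_sum_pow_smul_mem W (a i) (fun v => ?_) j
  refine mem_of_sum_pow_smul_mem W
    (fun i => ∑ j : Fin (N + 1), v ^ (N - (j : ℕ)) • a i j) (fun u => ?_) i
  simpa only [Finset.smul_sum, smul_smul] using h u v

end Coefficients

section Center

variable {N : ℕ} {K : Fin N → Module.End ℂ (Rzl N)}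

lemma mulP_X_inr_mem_cherednik (i : Fin N) : mulP N (X (Sum.inr i)) ∈ cherednik N K :=
  Algebra.subset_adjoin (Or.inl (Or.inl ⟨i, rfl⟩))

lemma mem_cherednik (i : Fin N) : K i ∈ cherednik N K :=
  Algebra.subset_adjoin (Or.inl (Or.inr ⟨i, rfl⟩))

lemma permRep_mem_cherednik (σ : Equiv.Perm (Fin N)) : permRep N σ ∈ cherednik N K :=
  Algebra.subset_adjoin (Or.inr ⟨σ, rfl⟩)

lemma mulP_one : mulP N 1 = 1 := by
  refine LinearMap.ext fun p => ?_
  simp [mulP_apply]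

lemma normalSum_mem_cherednik (u v : ℂ) (S : Finset (Fin N)) :
    normalSum (fun i => C v - X (Sum.inr i)) (fun i => u • (1 : Module.End ℂ (Rzl N)) - K i) S ∈
      cherednik N K := by
  refine Subalgebra.sum_mem _ fun T _ => Subalgebra.zsmul_mem _ (Subalgebra.mul_mem _ ?_ ?_) _
  · clear * -
    induction T using Finset.induction_on with
    | empty =>
      rw [Finset.prod_empty, mulP_one]
      exact Subalgebra.one_mem _
    | insert k T hk ih =>
      rw [Finset.prod_insert hk, mulP_mul, mulP_sub, mulP_C]
      exact Subalgebra.mul_mem _ (Subalgebra.sub_mem _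
        (Subalgebra.smul_mem _ (Subalgebra.one_mem _) _) (mulP_X_inr_mem_cherednik k)) ih
  · refine Subalgebra.list_prod_mem _ fun A hA => ?_
    obtain ⟨k, -, rfl⟩ := List.mem_map.1 hA
    exact Subalgebra.sub_mem _ (Subalgebra.smul_mem _ (Subalgebra.one_mem _) _) (mem_cherednik k)

lemma Puv_mem_cherednik (u v : ℂ) : Puv K u v ∈ cherednik N K := by
  rw [Puv_eq]
  exact Subalgebra.zsmul_mem _ (Subalgebra.sum_mem _ fun σ _ => Subalgebra.zsmul_mem _
    (Subalgebra.mul_mem _ (normalSum_mem_cherednik u v _) (permRep_mem_cherednik σ)) _) _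

lemma IsDunkl.Puv_mem_center {D : Fin N → Fin N → Rzl N → Rzl N} (h : IsDunkl D K) (u v : ℂ) :
    Puv K u v ∈ cherednikCenter N K := by
  refine ⟨Puv_mem_cherednik u v, ?_⟩
  have hle : cherednik N K ≤ Subalgebra.centralizer ℂ {Puv K u v} := by
    refine Algebra.adjoin_le ?_
    rw [h.Puv_eq_gaudinOp]
    rintro A ((⟨i, rfl⟩ | ⟨i, rfl⟩) | ⟨σ, rfl⟩) B rfl
    · exact gaudinOp_commute_inr u v i
    · exact h.gaudinOp_commute u v i
    · exact gaudinOp_perm u v σ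
  exact fun A hA => (hle hA _ rfl).symm

lemma IsDunkl.coeff_mem_center {D : Fin N → Fin N → Rzl N → Rzl N} (h : IsDunkl D K)
    {c : Fin (N + 1) → Fin (N + 1) → Module.End ℂ (Rzl N)}
    (hc : ∀ u v : ℂ, Puv K u v = ∑ i : Fin (N + 1), ∑ j : Fin (N + 1),
        (v ^ (N - (i : ℕ)) * u ^ (N - (j : ℕ))) • c i j) (i j : Fin (N + 1)) :
    c i j ∈ cherednikCenter N K := by
  refine mem_of_sum_sum_pow_smul_mem (Subalgebra.toSubmodule (cherednikCenter N K)) c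
    (fun v u => ?_) i j
  rw [← hc]
  exact h.Puv_mem_center u v

lemma commute_of_mem_center {A B : Module.End ℂ (Rzl N)} (hA : A ∈ cherednikCenter N K)
    (hB : B ∈ cherednikCenter N K) : Commute A B :=
  hB.2 A hA.1

end Center

section Intertwiners

variable {V W ι κ : Type*} [AddCommGroup V] [Module ℂ V] [AddCommGroup W] [Module ℂ W]

lemma lift_intertwine {Φ : V →ₗ[ℂ] W} {b : κ → Module.End ℂ V} {c : κ → Module.End ℂ W}
    (h : ∀ x F, Φ (b x F) = c x (Φ F)) (f : FreeAlgebra ℂ κ) (F : V) :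
    Φ (FreeAlgebra.lift ℂ b f F) = FreeAlgebra.lift ℂ c f (Φ F) := by
  induction f using FreeAlgebra.induction generalizing F with
  | grade0 r => simp
  | grade1 x => simpa using h x F
  | mul f g hf hg => simp [hf, hg]
  | add f g hf hg => simp [hf, hg]

/-- Two families of operators related by a surjective and jointly injective family of
intertwiners satisfy the same polynomial relations. -/
lemma lift_eq_zero_iff {Φ : ι → V →ₗ[ℂ] W} {b : κ → Module.End ℂ V} {c : κ → Module.End ℂ W}
    (h : ∀ r x F, Φ r (b x F) = c x (Φ r F)) (hinj : ∀ F, (∀ r, Φ r F = 0) → F = 0)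
    {r₀ : ι} (hsurj : Function.Surjective (Φ r₀)) (f : FreeAlgebra ℂ κ) :
    FreeAlgebra.lift ℂ b f = 0 ↔ FreeAlgebra.lift ℂ c f = 0 := by
  refine ⟨fun hf => LinearMap.ext fun w => ?_, fun hf => LinearMap.ext fun F =>
    hinj _ fun r => ?_⟩
  · obtain ⟨F, rfl⟩ := hsurj w
    rw [← lift_intertwine (h r₀), hf]
    simp
  · rw [lift_intertwine (h r), hf]
    simp

variable {A B : Type*} [Ring A] [Algebra ℂ A] [Ring B] [Algebra ℂ B]

lemma commute_of_lift_eq_zero_iff {b : κ → A} {c : κ → B}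
    (h : ∀ f, FreeAlgebra.lift ℂ b f = 0 ↔ FreeAlgebra.lift ℂ c f = 0) {x y : κ}
    (hxy : Commute (c x) (c y)) : Commute (b x) (b y) := by
  have := (h (FreeAlgebra.ι ℂ x * FreeAlgebra.ι ℂ y - FreeAlgebra.ι ℂ y * FreeAlgebra.ι ℂ x)).2
    (by simpa [sub_eq_zero] using hxy.eq)
  simpa [sub_eq_zero, commute_iff_eq] using this

lemma exists_equiv_of_lift_eq_zero_iff {b : κ → A} {c : κ → B}
    (h : ∀ f, FreeAlgebra.lift ℂ b f = 0 ↔ FreeAlgebra.lift ℂ c f = 0) :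
    ∃ φ : Algebra.adjoin ℂ (Set.range b) ≃ₐ[ℂ] Algebra.adjoin ℂ (Set.range c),
      ∀ (x : κ) (hx : b x ∈ Algebra.adjoin ℂ (Set.range b)), (φ ⟨b x, hx⟩ : B) = c x := by
  have hb := Algebra.adjoin_range_eq_range_freeAlgebra_lift ℂ κ b
  have hc := Algebra.adjoin_range_eq_range_freeAlgebra_lift ℂ κ c
  rw [hb, hc]
  have hsb := (FreeAlgebra.lift ℂ b).rangeRestrict_surjective
  have hsc := (FreeAlgebra.lift ℂ c).rangeRestrict_surjective
  have hker : RingHom.ker (FreeAlgebra.lift ℂ b).rangeRestrict =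
      RingHom.ker (FreeAlgebra.lift ℂ c).rangeRestrict := by
    ext f
    rw [RingHom.mem_ker, RingHom.mem_ker, Subtype.ext_iff, Subtype.ext_iff]
    exact h f
  refine ⟨((Ideal.quotientKerAlgEquivOfSurjective hsb).symm.trans
    (Ideal.quotientEquivAlgOfEq ℂ hker)).trans (Ideal.quotientKerAlgEquivOfSurjective hsc), ?_⟩
  intro x hx
  have hx' : (⟨b x, hx⟩ : (FreeAlgebra.lift ℂ b).range) =
      (FreeAlgebra.lift ℂ b).rangeRestrict (FreeAlgebra.ι ℂ x) := Subtype.ext (by simp)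
  have hs : (Ideal.quotientKerAlgEquivOfSurjective hsb).symm ⟨b x, hx⟩ =
      Ideal.Quotient.mk _ (FreeAlgebra.ι ℂ x) := by
    rw [AlgEquiv.symm_apply_eq, hx', Ideal.quotientKerAlgEquivOfSurjective_mk]
  rw [AlgEquiv.trans_apply, AlgEquiv.trans_apply, hs, Ideal.quotientEquivAlgOfEq_mk,
    Ideal.quotientKerAlgEquivOfSurjective_mk]
  simp

end Intertwiners

section Bethe

variable {N : ℕ}

lemma PB_apply (u v : ℂ) (G : V1 N) (ρ : Equiv.Perm (Fin N)) :
    PB N u v G ρ = ((-1 : ℤ) ^ N) • ∑ σ : Equiv.Perm (Fin N), (Equiv.Perm.sign σ : ℤ) •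
      ((∏ i ∈ Finset.univ.filter (fun i => σ i = i),
        (1 - (C u - X (Sum.inl ((σ⁻¹ * ρ)⁻¹ i))) * (C v - X (Sum.inr i)))) *
          G (σ⁻¹ * ρ)) := by
  rw [PB, LinearMap.smul_apply, LinearMap.sum_apply, Pi.smul_apply, Finset.sum_apply]
  rfl

/-- The map `r ε_τ ↦ τ^z(g r)` from `V_1` to `ℂ[z,λ]`. -/
def betheProj (g : Rzl N) : V1 N →ₗ[ℂ] Rzl N :=
  ∑ τ : Equiv.Perm (Fin N),
    (permZ N τ).toLinearMap ∘ₗ LinearMap.mulLeft ℂ g ∘ₗ LinearMap.proj τ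

lemma betheProj_apply (g : Rzl N) (G : V1 N) :
    betheProj g G = ∑ τ : Equiv.Perm (Fin N), permZ N τ (g * G τ) := by
  rw [betheProj, LinearMap.sum_apply]
  rfl

lemma betheProj_PB (g : Rzl N) (u v : ℂ) (G : V1 N) :
    betheProj g (PB N u v G) = gaudinOp N u v (betheProj g G) := by
  rw [betheProj_apply, gaudinOp_apply, betheProj_apply]
  have h1 : ∀ τ : Equiv.Perm (Fin N), permZ N τ (g * PB N u v G τ) =
      ((-1 : ℤ) ^ N) • ∑ σ : Equiv.Perm (Fin N), (Equiv.Perm.sign σ : ℤ) •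
        (fixProd u v σ * permZ N τ (g * G (σ⁻¹ * τ))) := by
    intro τ
    rw [PB_apply, mul_smul_comm, map_zsmul, Finset.mul_sum, map_sum]
    congr 1
    refine Finset.sum_congr rfl fun σ _ => ?_
    rw [mul_smul_comm, map_zsmul, mul_left_comm, map_mul (permZ N τ)]
    congr 2
    rw [map_prod, fixProd]
    refine Finset.prod_congr rfl fun i hi => ?_
    have hi' : σ i = i := (Finset.mem_filter.1 hi).2
    have hu : ∀ w : ℂ, permZ N τ (C w) = C w := fun w => by simp [permZ]
    rw [map_sub, map_mul, map_sub, map_sub, permZ_inl, permZ_inr, hu, hu, map_one, mul_comm]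
    simp [hi']
  rw [Finset.sum_congr rfl fun τ _ => h1 τ, ← Finset.smul_sum, Finset.sum_comm]
  congr 1
  refine Finset.sum_congr rfl fun σ _ => ?_
  rw [← Finset.smul_sum, ← Finset.mul_sum, map_sum, ← sum_perm_mul_left σ]
  simp only [inv_mul_cancel_left, permZ_mul_apply]

/-- The map `r ε_τ ↦ r' ε_{τ⁻¹}`, where `r'` is obtained from `r` by exchanging the variables
`z` and `λ`. -/
def betheFlip (N : ℕ) : V1 N →ₗ[ℂ] V1 N :=
  LinearMap.pi fun τ => (rename Sum.swap).toLinearMap ∘ₗ LinearMap.proj τ⁻¹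

lemma betheFlip_apply (G : V1 N) (τ : Equiv.Perm (Fin N)) :
    betheFlip N G τ = rename Sum.swap (G τ⁻¹) := rfl

lemma betheFlip_betheFlip (G : V1 N) : betheFlip N (betheFlip N G) = G := by
  funext τ
  rw [betheFlip_apply, betheFlip_apply, inv_inv, rename_rename]
  simp

lemma betheFlip_PB (u v : ℂ) (G : V1 N) :
    betheFlip N (PB N u v G) = PB N v u (betheFlip N G) := by
  funext τ
  rw [betheFlip_apply, PB_apply, PB_apply, map_zsmul, map_sum, ← sum_perm_conj τ⁻¹,
    ← Equiv.sum_comp (Equiv.inv _)]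
  congr 1
  refine Finset.sum_congr rfl fun σ _ => ?_
  have hs : Equiv.Perm.sign (τ⁻¹ * σ⁻¹ * τ) = Equiv.Perm.sign σ := by
    rw [Equiv.Perm.sign_mul, Equiv.Perm.sign_mul, Equiv.Perm.sign_inv, Equiv.Perm.sign_inv,
      mul_right_comm, Int.units_mul_self, one_mul]
  rw [map_zsmul, Equiv.inv_apply, inv_inv, hs, betheFlip_apply, map_mul (rename Sum.swap)]
  congr 2
  · rw [map_prod]
    refine Finset.prod_equiv τ (fun i => ?_) fun i hi => ?_
    · rw [Finset.mem_filter, Finset.mem_filter]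
      simp only [Finset.mem_univ, true_and, Equiv.Perm.mul_apply, Equiv.Perm.inv_eq_iff_eq]
      exact eq_comm
    · have hi' : σ⁻¹ (τ i) = τ i := by
        have := (Finset.mem_filter.1 hi).2
        rwa [Equiv.Perm.mul_apply, Equiv.Perm.mul_apply, Equiv.Perm.inv_eq_iff_eq] at this
      have hi'' : σ (τ i) = τ i := by rw [Equiv.Perm.inv_eq_iff_eq] at hi'; exact hi'.symm
      have hτ : τ⁻¹ (τ i) = i := τ.symm_apply_apply i
      simp only [map_sub, map_mul, map_one, rename_C, rename_X, Sum.swap_inl, Sum.swap_inr,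
        mul_inv_rev, inv_inv, Equiv.Perm.mul_apply, hτ, hi', hi'']
      ring
  · simp [mul_assoc]

lemma betheProj_one_surjective : Function.Surjective (betheProj (N := N) 1) := by
  intro p
  refine ⟨Pi.single 1 p, ?_⟩
  rw [betheProj_apply, Finset.sum_eq_single 1]
  · simp
  · intro τ _ hτ
    simp [hτ]
  · simp

lemma permZ_injective (τ : Equiv.Perm (Fin N)) : Function.Injective (permZ N τ) :=
  rename_injective _ (Sum.map_injective.2 ⟨τ.injective, Function.injective_id⟩)

lemma linearIndependent_permZ :
    LinearIndependent (Rzl N) fun τ : Equiv.Perm (Fin N) => (permZ N τ : Rzl N → Rzl N) := by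
  have hinj : Function.Injective fun τ : Equiv.Perm (Fin N) => (permZ N τ : Rzl N →* Rzl N) := by
    intro σ τ h
    ext1 i
    have := DFunLike.congr_fun h (X (Sum.inl i))
    have h' : (X (Sum.inl (σ i)) : Rzl N) = X (Sum.inl (τ i)) := by
      rw [← permZ_inl, ← permZ_inl]; exact this
    exact Sum.inl_injective (X_injective h')
  exact (linearIndependent_monoidHom (Rzl N) (Rzl N)).comp _ hinj

lemma eq_zero_of_betheProj_eq_zero {G : V1 N} (h : ∀ g, betheProj g G = 0) : G = 0 := by
  have := Fintype.linearIndependent_iff.1 (linearIndependent_permZ (N := N))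
    (fun τ => permZ N τ (G τ)) ?_
  · funext τ
    exact permZ_injective τ ((this τ).trans (map_zero _).symm)
  · funext g
    rw [Finset.sum_apply, Pi.zero_apply, ← h g, betheProj_apply]
    refine Finset.sum_congr rfl fun τ _ => ?_
    rw [map_mul, mul_comm]
    rfl

variable {D : Fin N → Fin N → Rzl N → Rzl N} {K : Fin N → Module.End ℂ (Rzl N)}

lemma IsDunkl.intertwine (h : IsDunkl D K)
    {c : Fin (N + 1) → Fin (N + 1) → Module.End ℂ (Rzl N)}
    (hc : ∀ u v : ℂ, Puv K u v = ∑ i : Fin (N + 1), ∑ j : Fin (N + 1),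
        (v ^ (N - (i : ℕ)) * u ^ (N - (j : ℕ))) • c i j)
    {bb : Fin (N + 1) → Fin (N + 1) → Module.End ℂ (V1 N)}
    (hb : ∀ u v : ℂ, PB N u v = ∑ i : Fin (N + 1), ∑ j : Fin (N + 1),
        (u ^ (N - (i : ℕ)) * v ^ (N - (j : ℕ))) • bb i j)
    (g : Rzl N) (i j : Fin (N + 1)) (G : V1 N) :
    (betheProj g ∘ₗ betheFlip N) (bb i j G) = c i j ((betheProj g ∘ₗ betheFlip N) G) := by
  have := mem_of_sum_sum_pow_smul_mem (V := Rzl N) ⊥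
    (fun i j => (betheProj g ∘ₗ betheFlip N) (bb i j G) -
      c i j ((betheProj g ∘ₗ betheFlip N) G)) (fun u v => ?_) i j
  · exact sub_eq_zero.1 ((Submodule.mem_bot ℂ).1 this)
  · have h1 := congrArg (betheProj g ∘ₗ betheFlip N) (LinearMap.congr_fun (hb u v) G)
    have h2 := LinearMap.congr_fun (hc v u) ((betheProj g ∘ₗ betheFlip N) G)
    rw [h.Puv_eq_gaudinOp, LinearMap.comp_apply, ← betheProj_PB, ← betheFlip_PB] at h2
    rw [LinearMap.comp_apply, h2] at h1
    simp only [LinearMap.sum_apply, LinearMap.smul_apply, map_sum, map_smul] at h1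
    simp only [smul_sub, Finset.sum_sub_distrib]
    rw [Submodule.mem_bot, sub_eq_zero]
    exact h1.symm

lemma IsDunkl.lift_eq_zero_iff (h : IsDunkl D K)
    {c : Fin (N + 1) → Fin (N + 1) → Module.End ℂ (Rzl N)}
    (hc : ∀ u v : ℂ, Puv K u v = ∑ i : Fin (N + 1), ∑ j : Fin (N + 1),
        (v ^ (N - (i : ℕ)) * u ^ (N - (j : ℕ))) • c i j)
    {bb : Fin (N + 1) → Fin (N + 1) → Module.End ℂ (V1 N)}
    (hb : ∀ u v : ℂ, PB N u v = ∑ i : Fin (N + 1), ∑ j : Fin (N + 1),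
        (u ^ (N - (i : ℕ)) * v ^ (N - (j : ℕ))) • bb i j)
    (f : FreeAlgebra ℂ (Fin (N + 1) × Fin (N + 1))) :
    FreeAlgebra.lift ℂ (fun x => bb x.1 x.2) f = 0 ↔
      FreeAlgebra.lift ℂ (fun x => c x.1 x.2) f = 0 := by
  refine _root_.lift_eq_zero_iff (Φ := fun g : Rzl N => betheProj g ∘ₗ betheFlip N)
    (fun g x G => h.intertwine hc hb g x.1 x.2 G) (fun G hG => ?_) (r₀ := 1) ?_ f
  · rw [← betheFlip_betheFlip G, eq_zero_of_betheProj_eq_zero hG, map_zero]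
  · exact betheProj_one_surjective.comp fun G => ⟨_, betheFlip_betheFlip G⟩

end Bethe

section Filtration

variable {ι κ : Type*}

/-- The polynomials of total degree less than `n`, as a submodule. -/
def degreeBelow (ι : Type*) (n : ℕ) : Submodule ℂ (MvPolynomial ι ℂ) :=
  restrictSupport ℂ {s | s.degree < n}

lemma mem_degreeBelow {n : ℕ} {p : MvPolynomial ι ℂ} :
    p ∈ degreeBelow ι n ↔ ∀ s ∈ p.support, s.degree < n := by
  rw [degreeBelow, mem_restrictSupport_iff]
  rfl

lemma degreeBelow_mono {m n : ℕ} (h : m ≤ n) : degreeBelow ι m ≤ degreeBelow ι n :=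
  restrictSupport_mono ℂ fun _ hs => lt_of_lt_of_le hs h

lemma eq_zero_of_mem_degreeBelow {p : MvPolynomial ι ℂ} (h : p ∈ degreeBelow ι 0) : p = 0 := by
  rw [← support_eq_empty, Finset.eq_empty_iff_forall_notMem]
  exact fun s hs => absurd (mem_degreeBelow.1 h s hs) (Nat.not_lt_zero _)

lemma mul_mem_degreeBelow {a b n : ℕ} {p q : MvPolynomial ι ℂ} (hp : p ∈ degreeBelow ι a)
    (hq : q ∈ degreeBelow ι b) (h : a + b ≤ n + 1) : p * q ∈ degreeBelow ι n := by
  classical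
  rw [mem_degreeBelow] at *
  intro s hs
  obtain ⟨t, ht, r, hr, rfl⟩ := Finset.mem_add.1 (support_mul p q hs)
  have h1 := hp t ht
  have h2 := hq r hr
  rw [map_add]
  omega

lemma monomial_mem_degreeBelow {n : ℕ} {s : ι →₀ ℕ} (h : s.degree < n) (r : ℂ) :
    monomial s r ∈ degreeBelow ι n :=
  (monomial_mem_restrictSupport ℂ).2 (Or.inl h)

lemma one_mem_degreeBelow : (1 : MvPolynomial ι ℂ) ∈ degreeBelow ι 1 :=
  monomial_mem_degreeBelow (by simp) 1

lemma X_mem_degreeBelow (i : ι) : (X i : MvPolynomial ι ℂ) ∈ degreeBelow ι 2 :=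
  monomial_mem_degreeBelow (by simp) 1

lemma rename_mem_degreeBelow {n : ℕ} {f : ι → κ} (hf : Function.Injective f)
    {p : MvPolynomial ι ℂ} (h : p ∈ degreeBelow ι n) : rename f p ∈ degreeBelow κ n := by
  classical
  rw [mem_degreeBelow] at *
  rw [support_rename_of_injective hf]
  intro s hs
  obtain ⟨t, ht, rfl⟩ := Finset.mem_image.1 hs
  rw [Finsupp.degree_mapDomain]
  exact h t ht

lemma exists_mem_degreeBelow (p : MvPolynomial ι ℂ) : ∃ n, p ∈ degreeBelow ι n := by
  refine ⟨p.support.sup Finsupp.degree + 1, mem_degreeBelow.2 fun s hs => ?_⟩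
  exact Nat.lt_succ_of_le (Finset.le_sup (f := Finsupp.degree) hs)

end Filtration

section Symbols

variable {N : ℕ}

/-- The operator `A` agrees with multiplication by `f`, of degree at most `d`, up to terms
raising degrees by less than `d`. -/
def HasSymbol (d : ℕ) (f : Rzl N) (A : Module.End ℂ (Rzl N)) : Prop :=
  f ∈ degreeBelow (Fin N ⊕ Fin N) (d + 1) ∧
    ∀ n, ∀ p ∈ degreeBelow (Fin N ⊕ Fin N) (n + 1),
      A p - f * p ∈ degreeBelow (Fin N ⊕ Fin N) (n + d)

lemma HasSymbol.add {d : ℕ} {f g : Rzl N} {A B : Module.End ℂ (Rzl N)} (hA : HasSymbol d f A)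
    (hB : HasSymbol d g B) : HasSymbol d (f + g) (A + B) := by
  refine ⟨add_mem hA.1 hB.1, fun n p hp => ?_⟩
  have : (A + B) p - (f + g) * p = (A p - f * p) + (B p - g * p) := by
    rw [LinearMap.add_apply]
    ring
  rw [this]
  exact add_mem (hA.2 n p hp) (hB.2 n p hp)

lemma HasSymbol.smul {d : ℕ} {f : Rzl N} {A : Module.End ℂ (Rzl N)} (r : ℂ)
    (hA : HasSymbol d f A) : HasSymbol d (r • f) (r • A) := by
  refine ⟨Submodule.smul_mem _ _ hA.1, fun n p hp => ?_⟩
  rw [LinearMap.smul_apply, smul_mul_assoc, ← smul_sub]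
  exact Submodule.smul_mem _ _ (hA.2 n p hp)

lemma HasSymbol.mul {d e : ℕ} {f g : Rzl N} {A B : Module.End ℂ (Rzl N)} (hA : HasSymbol d f A)
    (hB : HasSymbol e g B) : HasSymbol (d + e) (f * g) (A * B) := by
  refine ⟨mul_mem_degreeBelow hA.1 hB.1 (by omega), fun n p hp => ?_⟩
  have hgp : g * p ∈ degreeBelow (Fin N ⊕ Fin N) (n + e + 1) :=
    mul_mem_degreeBelow hB.1 hp (by omega)
  have hBp : B p ∈ degreeBelow (Fin N ⊕ Fin N) (n + e + 1) := by
    rw [← sub_add_cancel (B p) (g * p)]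
    exact add_mem (degreeBelow_mono (Nat.le_succ _) (hB.2 n p hp)) hgp
  have : (A * B) p - f * g * p = (A (B p) - f * B p) + f * (B p - g * p) := by
    rw [Module.End.mul_apply]
    ring
  rw [this]
  exact add_mem (degreeBelow_mono (by omega) (hA.2 _ _ hBp))
    (mul_mem_degreeBelow hA.1 (hB.2 n p hp) (by omega))

lemma hasSymbol_mulP {d : ℕ} {f : Rzl N} (hf : f ∈ degreeBelow (Fin N ⊕ Fin N) (d + 1)) :
    HasSymbol d f (mulP N f) := by
  refine ⟨hf, fun n p _ => ?_⟩
  rw [mulP_apply, sub_self]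
  exact zero_mem _

lemma HasSymbol.apply_one_sub_mem {d : ℕ} {f : Rzl N} {A : Module.End ℂ (Rzl N)}
    (hA : HasSymbol d f A) : A 1 - f ∈ degreeBelow (Fin N ⊕ Fin N) d := by
  simpa using hA.2 0 1 one_mem_degreeBelow

/-- The symbols of degree `d` of the operators belonging to `𝒜`. -/
def symbols (𝒜 : Subalgebra ℂ (Module.End ℂ (Rzl N))) (d : ℕ) : Submodule ℂ (Rzl N) where
  carrier := {f | ∃ A ∈ 𝒜, HasSymbol d f A}
  add_mem' := fun ⟨A, hA, hf⟩ ⟨B, hB, hg⟩ => ⟨A + B, add_mem hA hB, hf.add hg⟩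
  zero_mem' := ⟨0, zero_mem _, zero_mem _, fun n p _ => by simp⟩
  smul_mem' r _ := fun ⟨A, hA, hf⟩ => ⟨r • A, Subalgebra.smul_mem _ hA r, hf.smul r⟩

variable {𝒜 : Subalgebra ℂ (Module.End ℂ (Rzl N))}

lemma mul_mem_symbols {d e n : ℕ} {f g : Rzl N} (hf : f ∈ symbols 𝒜 d) (hg : g ∈ symbols 𝒜 e)
    (h : d + e = n) : f * g ∈ symbols 𝒜 n := by
  obtain ⟨A, hA, hfA⟩ := hf
  obtain ⟨B, hB, hgB⟩ := hg
  exact ⟨A * B, mul_mem hA hB, h ▸ hfA.mul hgB⟩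

lemma one_mem_symbols : (1 : Rzl N) ∈ symbols 𝒜 0 :=
  ⟨1, one_mem _, mulP_one (N := N) ▸ hasSymbol_mulP one_mem_degreeBelow⟩

end Symbols

section RootCoefficients

variable {ι R : Type*} [CommRing R]

/-- The coefficients of the polynomial with roots `x i`, `i ∈ T`. -/
def rootCoeff (x : ι → R) (T : Finset ι) (k : ℕ) : R :=
  (∏ i ∈ T, (Polynomial.X - Polynomial.C (x i))).coeff k

lemma rootCoeff_card (x : ι → R) (T : Finset ι) : rootCoeff x T T.card = 1 := by
  nontriviality R
  have h := Polynomial.monic_prod_X_sub_C x T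
  have hd : (∏ i ∈ T, (Polynomial.X - Polynomial.C (x i))).natDegree = T.card := by
    rw [Polynomial.natDegree_finsetProd_X_sub_C_eq_card]
  rw [rootCoeff, ← hd]
  exact h

lemma rootCoeff_insert_zero [DecidableEq ι] (x : ι → R) {T : Finset ι} {i : ι} (hi : i ∉ T) :
    rootCoeff x (insert i T) 0 = -(x i * rootCoeff x T 0) := by
  rw [rootCoeff, Finset.prod_insert hi, rootCoeff]
  simp [sub_mul]

lemma rootCoeff_insert_succ [DecidableEq ι] (x : ι → R) {T : Finset ι} {i : ι} (hi : i ∉ T)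
    (k : ℕ) :
    rootCoeff x (insert i T) (k + 1) = rootCoeff x T k - x i * rootCoeff x T (k + 1) := by
  rw [rootCoeff, Finset.prod_insert hi, rootCoeff, rootCoeff, sub_mul, Polynomial.coeff_sub,
    Polynomial.coeff_X_mul, Polynomial.coeff_C_mul]

lemma prod_sub_eq_sum_rootCoeff {N : ℕ} (x : ι → R) (T : Finset ι) (hT : T.card ≤ N) (u : R) :
    ∏ i ∈ T, (u - x i) = ∑ k : Fin (N + 1), u ^ (N - (k : ℕ)) * rootCoeff x T (N - k) := by
  nontriviality R
  have hd : (∏ i ∈ T, (Polynomial.X - Polynomial.C (x i))).natDegree < N + 1 := by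
    rw [Polynomial.natDegree_finsetProd_X_sub_C_eq_card]
    omega
  have h := Polynomial.eval_eq_sum_range' hd u
  rw [Polynomial.eval_prod] at h
  simp only [Polynomial.eval_sub, Polynomial.eval_X, Polynomial.eval_C] at h
  rw [h, ← Finset.sum_range_reflect, Finset.sum_range]
  refine Finset.sum_congr rfl fun k _ => ?_
  rw [rootCoeff, Nat.add_sub_cancel, mul_comm]

lemma rootCoeff_mem_degreeBelow {κ : Type*} {x : ι → MvPolynomial κ ℂ}
    (hx : ∀ i, x i ∈ degreeBelow κ 2) (T : Finset ι) {k n : ℕ} (h : T.card < n + k) :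
    rootCoeff x T k ∈ degreeBelow κ n := by
  classical
  induction T using Finset.induction_on generalizing k n with
  | empty =>
    rw [rootCoeff, Finset.prod_empty, Polynomial.coeff_one]
    split_ifs with hk
    · subst hk
      exact degreeBelow_mono (Nat.succ_le_of_lt (by simpa using h)) one_mem_degreeBelow
    · exact zero_mem _
  | insert i T hi ih =>
    rw [Finset.card_insert_of_notMem hi] at h
    have hmul : ∀ j, T.card + 1 < n + j → x i * rootCoeff x T j ∈ degreeBelow κ n := by
      intro j hj
      rcases n with _ | n
      · rw [eq_zero_of_mem_degreeBelow (ih (k := j) (n := 0) (by omega)), mul_zero]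
        exact zero_mem _
      · exact mul_mem_degreeBelow (hx i) (ih (k := j) (n := n) (by omega)) (by omega)
    rcases k with _ | k
    · rw [rootCoeff_insert_zero x hi]
      exact neg_mem (hmul 0 h)
    · rw [rootCoeff_insert_succ x hi]
      exact sub_mem (ih (by omega)) (hmul _ (by omega))

end RootCoefficients

section CoefficientSymbols

variable {N : ℕ}

/-- The coefficients of `fixProd` with respect to `v` and `u`. -/
def fixCoeff (l k : ℕ) (σ : Equiv.Perm (Fin N)) : Rzl N :=
  ∑ T ∈ (Finset.univ.filter fun i => σ i = i).powerset, (-1) ^ T.card *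
    (rootCoeff (fun i => X (Sum.inr i)) T l * rootCoeff (fun i => X (Sum.inl i)) T k)

lemma fixProd_eq_sum (u v : ℂ) (σ : Equiv.Perm (Fin N)) :
    fixProd u v σ = ∑ i : Fin (N + 1), ∑ j : Fin (N + 1),
      (v ^ (N - (i : ℕ)) * u ^ (N - (j : ℕ))) • fixCoeff (N - i) (N - j) σ := by
  have hT : ∀ T : Finset (Fin N),
      ∏ i ∈ T, -((C v - X (Sum.inr i)) * (C u - X (Sum.inl i)) : Rzl N) =
        ∑ i : Fin (N + 1), ∑ j : Fin (N + 1), (v ^ (N - (i : ℕ)) * u ^ (N - (j : ℕ))) •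
          ((-1) ^ T.card * (rootCoeff (fun i => X (Sum.inr i)) T (N - i) *
            rootCoeff (fun i => X (Sum.inl i)) T (N - j))) := by
    intro T
    have hN : T.card ≤ N := by simpa using T.card_le_univ
    rw [Finset.prod_neg, Finset.prod_mul_distrib,
      prod_sub_eq_sum_rootCoeff (fun i => (X (Sum.inr i) : Rzl N)) T hN,
      prod_sub_eq_sum_rootCoeff (fun i => (X (Sum.inl i) : Rzl N)) T hN, Finset.sum_mul_sum,
      Finset.mul_sum]
    refine Finset.sum_congr rfl fun i _ => ?_
    rw [Finset.mul_sum]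
    refine Finset.sum_congr rfl fun j _ => ?_
    rw [smul_eq_C_mul, C_mul, C_pow, C_pow]
    ring
  rw [fixProd]
  simp only [sub_eq_add_neg (1 : Rzl N), Finset.prod_one_add]
  rw [Finset.sum_congr rfl fun T _ => hT T, Finset.sum_comm]
  refine Finset.sum_congr rfl fun i _ => ?_
  rw [Finset.sum_comm]
  refine Finset.sum_congr rfl fun j _ => ?_
  rw [fixCoeff, Finset.smul_sum]

variable {D : Fin N → Fin N → Rzl N → Rzl N} {K : Fin N → Module.End ℂ (Rzl N)}

lemma IsDunkl.coeff_apply (h : IsDunkl D K)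
    {c : Fin (N + 1) → Fin (N + 1) → Module.End ℂ (Rzl N)}
    (hc : ∀ u v : ℂ, Puv K u v = ∑ i : Fin (N + 1), ∑ j : Fin (N + 1),
        (v ^ (N - (i : ℕ)) * u ^ (N - (j : ℕ))) • c i j) (i j : Fin (N + 1)) (p : Rzl N) :
    c i j p = ∑ σ : Equiv.Perm (Fin N),
      C (((-1 : ℤ) ^ N * (Equiv.Perm.sign σ : ℤ) : ℤ) : ℂ) *
        (fixCoeff (N - i) (N - j) σ * permZ N σ p) := by
  have := mem_of_sum_sum_pow_smul_mem (V := Rzl N) ⊥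
    (fun i j => c i j p - ∑ σ : Equiv.Perm (Fin N),
      C (((-1 : ℤ) ^ N * (Equiv.Perm.sign σ : ℤ) : ℤ) : ℂ) *
        (fixCoeff (N - i) (N - j) σ * permZ N σ p)) (fun v u => ?_) i j
  · exact sub_eq_zero.1 ((Submodule.mem_bot ℂ).1 this)
  · have h1 := LinearMap.congr_fun (hc u v) p
    rw [h.Puv_eq_gaudinOp, gaudinOp_apply] at h1
    simp only [LinearMap.sum_apply, LinearMap.smul_apply] at h1
    simp only [smul_sub, Finset.sum_sub_distrib]
    rw [Submodule.mem_bot, ← h1, sub_eq_zero, Finset.smul_sum]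
    simp only [Finset.smul_sum]
    conv_rhs => enter [2, i]; rw [Finset.sum_comm]
    rw [Finset.sum_comm]
    refine Finset.sum_congr rfl fun σ _ => ?_
    rw [fixProd_eq_sum, smul_smul, Finset.sum_mul, zsmul_eq_mul, Finset.mul_sum]
    refine Finset.sum_congr rfl fun i _ => ?_
    rw [Finset.sum_mul, Finset.mul_sum]
    refine Finset.sum_congr rfl fun j _ => ?_
    rw [smul_mul_assoc, mul_smul_comm, map_intCast]

lemma sum_finset_sub_mem {ι V : Type*} [Fintype ι] [DecidableEq ι] [AddCommGroup V] [Module ℂ V]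
    (W : Submodule ℂ V) (F : Finset ι → V)
    (hF : ∀ S : Finset ι, S.card + 2 ≤ Fintype.card ι → F S ∈ W) :
    ∑ S : Finset ι, F S - F Finset.univ - ∑ i, F {i}ᶜ ∈ W := by
  have hinj : Function.Injective fun i : ι => ({i}ᶜ : Finset ι) := fun i j hij =>
    Finset.singleton_injective (compl_injective hij)
  have hu : (Finset.univ : Finset ι) ∉
      Finset.univ.map ⟨fun i : ι => ({i}ᶜ : Finset ι), hinj⟩ := by
    rw [Finset.mem_map]
    rintro ⟨i, -, hi⟩
    have : i ∈ ({i}ᶜ : Finset ι) := by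
      change ({i}ᶜ : Finset ι) = Finset.univ at hi
      rw [hi]
      exact Finset.mem_univ i
    simp at this
  rw [← Finset.sum_sdiff (Finset.subset_univ
      (insert Finset.univ (Finset.univ.map ⟨fun i : ι => ({i}ᶜ : Finset ι), hinj⟩))),
    Finset.sum_insert hu, Finset.sum_map, sub_sub]
  simp only [Function.Embedding.coeFn_mk]
  rw [add_sub_cancel_right]
  refine Submodule.sum_mem _ fun S hS => hF S ?_
  rw [Finset.mem_sdiff, Finset.mem_insert, Finset.mem_map, not_or] at hS
  obtain ⟨-, h1, h2⟩ := hS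
  have h3 : Sᶜ.card ≠ 0 := fun h => h1 (compl_eq_bot.1 (Finset.card_eq_zero.1 h))
  have h4 : Sᶜ.card ≠ 1 := fun h => h2 <| by
    obtain ⟨i, hi⟩ := Finset.card_eq_one.1 h
    exact ⟨i, Finset.mem_univ i, by change ({i}ᶜ : Finset ι) = S; rw [← hi, compl_compl]⟩
  have := S.card_add_card_compl
  omega

end CoefficientSymbols

section CoefficientSymbols

variable {N : ℕ}

lemma neg_one_pow_mul_mem {ι : Type*} (W : Submodule ℂ (MvPolynomial ι ℂ)) (n : ℕ)
    {p : MvPolynomial ι ℂ} (hp : p ∈ W) : (-1) ^ n * p ∈ W := by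
  rcases neg_one_pow_eq_or (MvPolynomial ι ℂ) n with h | h
  · rwa [h, one_mul]
  · rw [h, neg_one_mul]
    exact neg_mem hp

lemma rootCoeff_X_mem_degreeBelow {ι κ : Type*} (x : ι → κ) (T : Finset ι) {k n : ℕ}
    (h : T.card < n + k) :
    rootCoeff (fun i => (X (x i) : MvPolynomial κ ℂ)) T k ∈ degreeBelow κ n :=
  rootCoeff_mem_degreeBelow (fun i => X_mem_degreeBelow (x i)) T h

lemma rootCoeff_X_eq_zero {ι κ : Type*} (x : ι → κ) {T : Finset ι} {k : ℕ} (h : T.card < k) :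
    rootCoeff (fun i => (X (x i) : MvPolynomial κ ℂ)) T k = 0 :=
  eq_zero_of_mem_degreeBelow (rootCoeff_X_mem_degreeBelow x T (by omega))

lemma rootCoeff_univ_card {R : Type*} [CommRing R] (x : Fin N → R) :
    rootCoeff x Finset.univ N = 1 := by
  simpa using rootCoeff_card x Finset.univ

lemma card_add_two_le_of_subset_fixed {σ : Equiv.Perm (Fin N)} (hσ : σ ≠ 1) {T : Finset (Fin N)}
    (hT : T ∈ (Finset.univ.filter fun i => σ i = i).powerset) : T.card + 2 ≤ N := by
  have h1 := Equiv.Perm.two_le_card_support_of_ne_one hσ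
  have h2 := Finset.card_le_card (Finset.mem_powerset.1 hT)
  have h3 := Finset.card_filter_add_card_filter_not (s := (Finset.univ : Finset (Fin N)))
    (fun i => σ i = i)
  have h4 : σ.support = Finset.univ.filter fun i => ¬ σ i = i := by
    ext i
    simp
  rw [Finset.card_univ, Fintype.card_fin] at h3
  rw [h4] at h1
  omega

lemma fixCoeff_eq_zero {σ : Equiv.Perm (Fin N)} (hσ : σ ≠ 1) {l k : ℕ} (h : N ≤ l ∨ N ≤ k) :
    fixCoeff l k σ = 0 := by
  refine Finset.sum_eq_zero fun T hT => ?_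
  have := card_add_two_le_of_subset_fixed hσ hT
  rcases h with h | h
  · rw [rootCoeff_X_eq_zero Sum.inr (by omega), zero_mul, mul_zero]
  · rw [rootCoeff_X_eq_zero Sum.inl (by omega), mul_zero, mul_zero]

lemma fixCoeff_one_eq (l k : ℕ) : fixCoeff l k (1 : Equiv.Perm (Fin N)) =
    ∑ T : Finset (Fin N), (-1) ^ T.card *
      (rootCoeff (fun i => X (Sum.inr i)) T l * rootCoeff (fun i => X (Sum.inl i)) T k) := by
  simp [fixCoeff]

lemma fixCoeff_one_of_le {l k : ℕ} (h : N ≤ l ∨ N ≤ k) :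
    fixCoeff l k (1 : Equiv.Perm (Fin N)) = (-1) ^ N *
      (rootCoeff (fun i => X (Sum.inr i)) Finset.univ l *
        rootCoeff (fun i => X (Sum.inl i)) Finset.univ k) := by
  rw [fixCoeff_one_eq, Finset.sum_eq_single Finset.univ]
  · simp
  · intro T _ hT
    have : T.card < N := by
      simpa using Finset.card_lt_card (Finset.ssubset_univ_iff.2 hT)
    rcases h with h | h
    · rw [rootCoeff_X_eq_zero Sum.inr (by omega), zero_mul, mul_zero]
    · rw [rootCoeff_X_eq_zero Sum.inl (by omega), mul_zero, mul_zero]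
  · simp

lemma rootCoeff_mul_rootCoeff_mem {T : Finset (Fin N)} (hT : T.card + 2 ≤ N) {d l k : ℕ}
    (hl : l < N) (hk : k < N) (hd : d + l + k + 2 = 2 * N) :
    (-1) ^ T.card * (rootCoeff (fun i => X (Sum.inr i)) T l *
      rootCoeff (fun i => X (Sum.inl i)) T k) ∈ degreeBelow (Fin N ⊕ Fin N) d :=
  neg_one_pow_mul_mem _ _ (mul_mem_degreeBelow
    (rootCoeff_X_mem_degreeBelow Sum.inr T (n := N - 1 - l) (by omega))
    (rootCoeff_X_mem_degreeBelow Sum.inl T (n := N - k) (by omega)) (by omega))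

lemma fixCoeff_mem_degreeBelow {σ : Equiv.Perm (Fin N)} (hσ : σ ≠ 1) {d l k : ℕ}
    (hl : l < N) (hk : k < N) (hd : d + l + k + 2 = 2 * N) :
    fixCoeff l k σ ∈ degreeBelow (Fin N ⊕ Fin N) d :=
  Submodule.sum_mem _ fun _ hT =>
    rootCoeff_mul_rootCoeff_mem (card_add_two_le_of_subset_fixed hσ hT) hl hk hd

/-- The sum over `i` of the products of the coefficients of the polynomials whose roots are all
variables but those of index `i`. -/
def puncturedSum (N s t l k : ℕ) : Rzl N :=
  ∑ i, X (Sum.inl i) ^ s * X (Sum.inr i) ^ t * (rootCoeff (fun i => X (Sum.inr i)) {i}ᶜ l *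
    rootCoeff (fun i => X (Sum.inl i)) {i}ᶜ k)

lemma fixCoeff_one_sub_mem {d l k : ℕ} (hl : l < N) (hk : k < N) (hd : d + l + k + 2 = 2 * N) :
    fixCoeff l k (1 : Equiv.Perm (Fin N)) - (-1) ^ N *
      (rootCoeff (fun i => X (Sum.inr i)) Finset.univ l *
        rootCoeff (fun i => X (Sum.inl i)) Finset.univ k) + (-1) ^ N * puncturedSum N 0 0 l k ∈
      degreeBelow (Fin N ⊕ Fin N) d := by
  have := sum_finset_sub_mem (degreeBelow (Fin N ⊕ Fin N) d)
    (fun T : Finset (Fin N) => (-1) ^ T.card * (rootCoeff (fun i => X (Sum.inr i)) T l *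
      rootCoeff (fun i => X (Sum.inl i)) T k))
    (fun T hT => rootCoeff_mul_rootCoeff_mem (by simpa using hT) hl hk hd)
  rw [fixCoeff_one_eq]
  convert this using 1
  rw [sub_eq_add_neg _ (∑ i, _)]
  congr 1
  · simp
  · have hpow : ((-1) ^ N : Rzl N) = -(-1) ^ (N - 1) := by
      rw [← mul_neg_one ((-1) ^ (N - 1) : Rzl N), ← pow_succ, Nat.sub_add_cancel (by omega)]
    rw [hpow, puncturedSum, Finset.mul_sum, ← Finset.sum_neg_distrib]
    refine Finset.sum_congr rfl fun i _ => ?_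
    rw [Finset.card_compl, Finset.card_singleton, Fintype.card_fin]
    ring

lemma puncturedSum_mem_degreeBelow {d l k : ℕ} (hl : l < N) (hk : k < N)
    (hd : d + l + k + 2 = 2 * N) :
    puncturedSum N 0 0 l k ∈ degreeBelow (Fin N ⊕ Fin N) (d + 1) := by
  refine Submodule.sum_mem _ fun i _ => ?_
  have hi : ({i}ᶜ : Finset (Fin N)).card = N - 1 := by
    rw [Finset.card_compl, Finset.card_singleton, Fintype.card_fin]
  rw [pow_zero, pow_zero, one_mul, one_mul]
  exact mul_mem_degreeBelow
    (rootCoeff_X_mem_degreeBelow Sum.inr _ (n := N - l) (by omega))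
    (rootCoeff_X_mem_degreeBelow Sum.inl _ (n := N - k) (by omega)) (by omega)

variable {D : Fin N → Fin N → Rzl N → Rzl N} {K : Fin N → Module.End ℂ (Rzl N)}

lemma IsDunkl.coeff_apply_eq_add (h : IsDunkl D K)
    {c : Fin (N + 1) → Fin (N + 1) → Module.End ℂ (Rzl N)}
    (hc : ∀ u v : ℂ, Puv K u v = ∑ i : Fin (N + 1), ∑ j : Fin (N + 1),
        (v ^ (N - (i : ℕ)) * u ^ (N - (j : ℕ))) • c i j) {l k : ℕ} (hl : l ≤ N) (hk : k ≤ N)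
    (p : Rzl N) :
    c ⟨N - l, by omega⟩ ⟨N - k, by omega⟩ p = (-1) ^ N * (fixCoeff l k 1 * p) +
      ∑ σ ∈ Finset.univ.erase (1 : Equiv.Perm (Fin N)),
        C (((-1 : ℤ) ^ N * (Equiv.Perm.sign σ : ℤ) : ℤ) : ℂ) *
          (fixCoeff l k σ * permZ N σ p) := by
  rw [h.coeff_apply hc, ← Finset.add_sum_erase _ _ (Finset.mem_univ 1)]
  simp only [Nat.sub_sub_self hl, Nat.sub_sub_self hk, permZ_one_apply]
  simp

lemma IsDunkl.coeff_eq_mulP (h : IsDunkl D K)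
    {c : Fin (N + 1) → Fin (N + 1) → Module.End ℂ (Rzl N)}
    (hc : ∀ u v : ℂ, Puv K u v = ∑ i : Fin (N + 1), ∑ j : Fin (N + 1),
        (v ^ (N - (i : ℕ)) * u ^ (N - (j : ℕ))) • c i j) {l k : ℕ} (hl : l ≤ N) (hk : k ≤ N)
    (hlk : N ≤ l ∨ N ≤ k) :
    c ⟨N - l, by omega⟩ ⟨N - k, by omega⟩ =
      mulP N (rootCoeff (fun i => X (Sum.inr i)) Finset.univ l *
        rootCoeff (fun i => X (Sum.inl i)) Finset.univ k) := by
  refine LinearMap.ext fun p => ?_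
  rw [h.coeff_apply_eq_add hc hl hk, fixCoeff_one_of_le hlk, Finset.sum_eq_zero, add_zero,
    mulP_apply, ← mul_assoc, ← mul_assoc, ← mul_pow, neg_one_mul, neg_neg, one_pow, one_mul]
  intro σ hσ
  rw [fixCoeff_eq_zero (Finset.ne_of_mem_erase hσ) hlk, zero_mul, mul_zero]

variable {𝒜 : Subalgebra ℂ (Module.End ℂ (Rzl N))}

lemma IsDunkl.mulP_rootCoeff_inl_mem (h : IsDunkl D K)
    {c : Fin (N + 1) → Fin (N + 1) → Module.End ℂ (Rzl N)}
    (hc : ∀ u v : ℂ, Puv K u v = ∑ i : Fin (N + 1), ∑ j : Fin (N + 1),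
        (v ^ (N - (i : ℕ)) * u ^ (N - (j : ℕ))) • c i j) (hA : ∀ i j, c i j ∈ 𝒜) {k : ℕ}
    (hk : k ≤ N) : mulP N (rootCoeff (fun i => X (Sum.inl i)) Finset.univ k) ∈ 𝒜 := by
  have := h.coeff_eq_mulP hc le_rfl hk (Or.inl le_rfl)
  rw [rootCoeff_univ_card, one_mul] at this
  exact this ▸ hA _ _

lemma IsDunkl.mulP_rootCoeff_inr_mem (h : IsDunkl D K)
    {c : Fin (N + 1) → Fin (N + 1) → Module.End ℂ (Rzl N)}
    (hc : ∀ u v : ℂ, Puv K u v = ∑ i : Fin (N + 1), ∑ j : Fin (N + 1),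
        (v ^ (N - (i : ℕ)) * u ^ (N - (j : ℕ))) • c i j) (hA : ∀ i j, c i j ∈ 𝒜) {l : ℕ}
    (hl : l ≤ N) : mulP N (rootCoeff (fun i => X (Sum.inr i)) Finset.univ l) ∈ 𝒜 := by
  have := h.coeff_eq_mulP hc hl le_rfl (Or.inr le_rfl)
  rw [rootCoeff_univ_card, mul_one] at this
  exact this ▸ hA _ _

lemma mul_add_sub_mem {W W' : Submodule ℂ (Rzl N)} {e f F a b p S : Rzl N} (he : e * e = 1)
    (hS : S ∈ W) (hm : ∀ q ∈ W', e * (q * p) ∈ W) (hF : F - e * (a * b) + e * f ∈ W') :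
    a * b * p - (e * (F * p) + S) - f * p ∈ W := by
  have := neg_mem (add_mem (hm _ hF) hS)
  convert this using 1
  linear_combination -(a * b * p - f * p) * he

lemma IsDunkl.puncturedSum_mem_symbols (h : IsDunkl D K)
    {c : Fin (N + 1) → Fin (N + 1) → Module.End ℂ (Rzl N)}
    (hc : ∀ u v : ℂ, Puv K u v = ∑ i : Fin (N + 1), ∑ j : Fin (N + 1),
        (v ^ (N - (i : ℕ)) * u ^ (N - (j : ℕ))) • c i j) (hA : ∀ i j, c i j ∈ 𝒜) {d l k : ℕ}
    (hl : l < N) (hk : k < N) (hd : d + l + k + 2 = 2 * N) :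
    puncturedSum N 0 0 l k ∈ symbols 𝒜 d := by
  refine ⟨mulP N (rootCoeff (fun i => X (Sum.inr i)) Finset.univ l) *
    mulP N (rootCoeff (fun i => X (Sum.inl i)) Finset.univ k) -
      c ⟨N - l, by omega⟩ ⟨N - k, by omega⟩, sub_mem (mul_mem
        (h.mulP_rootCoeff_inr_mem hc hA hl.le) (h.mulP_rootCoeff_inl_mem hc hA hk.le)) (hA _ _),
    puncturedSum_mem_degreeBelow hl hk hd, fun n p hp => ?_⟩
  rw [LinearMap.sub_apply, h.coeff_apply_eq_add hc hl.le hk.le, ← mulP_mul, mulP_apply]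
  refine mul_add_sub_mem (by rw [← mul_pow, neg_one_mul, neg_neg, one_pow])
    (Submodule.sum_mem _ fun σ hσ => ?_) (fun q hq => ?_) (fixCoeff_one_sub_mem hl hk hd)
  · rw [← smul_eq_C_mul]
    refine Submodule.smul_mem _ _ (mul_mem_degreeBelow (fixCoeff_mem_degreeBelow
      (Finset.ne_of_mem_erase hσ) hl hk hd) (rename_mem_degreeBelow ?_ hp) (by omega))
    exact Sum.map_injective.2 ⟨σ.injective, Function.injective_id⟩
  · exact neg_one_pow_mul_mem _ _ (mul_mem_degreeBelow hq hp (by omega))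

end CoefficientSymbols

section EmbeddingSums

variable {ι M R : Type*} [Fintype ι] [CommRing R]

/-- The monomial symmetric function attached to `w`, as a sum over embeddings. -/
def embeddingSum (g : M → ι → R) {k : ℕ} (w : Fin k → M) : R :=
  ∑ e : Fin k ↪ ι, ∏ t, g (w t) (e t)

lemma sum_notMem_range [DecidableEq ι] {k : ℕ} (e : Fin k ↪ ι) (f : ι → R) :
    ∑ i : {i // i ∉ Set.range e}, f i = ∑ i, f i - ∑ t, f (e t) := by
  rw [eq_sub_iff_add_eq', ← Finset.sum_map Finset.univ e f,
    ← Finset.sum_add_sum_compl (Finset.univ.map e) f]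
  congr 1
  refine (Finset.sum_subtype _ (fun i => ?_) f).symm
  simp

lemma embeddingSum_succ [Add M] {g : M → ι → R} (hg : ∀ a b i, g (a + b) i = g a i * g b i)
    {k : ℕ} (w : Fin (k + 1) → M) :
    embeddingSum g w = (∑ i, g (w 0) i) * embeddingSum g (fun t => w t.succ) -
      ∑ t, embeddingSum g (Function.update (fun t => w t.succ) t (w 0 + w t.succ)) := by
  classical
  have h1 : embeddingSum g w = ∑ e : Fin k ↪ ι,
      (∑ i, g (w 0) i - ∑ t, g (w 0) (e t)) * ∏ t, g (w t.succ) (e t) := by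
    rw [embeddingSum, ← (Equiv.embeddingFinSucc k ι).symm.sum_comp, Fintype.sum_sigma]
    refine Finset.sum_congr rfl fun e _ => ?_
    rw [← sum_notMem_range, Finset.sum_mul]
    refine Finset.sum_congr rfl fun i _ => ?_
    rw [Fin.prod_univ_succ, Equiv.coe_embeddingFinSucc_symm]
    rfl
  rw [h1]
  simp only [embeddingSum]
  rw [Finset.sum_comm, Finset.mul_sum, ← Finset.sum_sub_distrib]
  refine Finset.sum_congr rfl fun e _ => ?_
  rw [sub_mul]
  congr 1
  rw [Finset.sum_mul]
  refine Finset.sum_congr rfl fun t _ => ?_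
  rw [← Finset.mul_prod_erase _ (fun s => g (w s.succ) (e s)) (Finset.mem_univ t),
    ← Finset.mul_prod_erase _
      (fun s => g (Function.update (fun t => w t.succ) t (w 0 + w t.succ) s) (e s))
      (Finset.mem_univ t),
    Function.update_self, hg, mul_assoc]
  congr 2
  refine Finset.prod_congr rfl fun s hs => ?_
  rw [Function.update_of_ne (Finset.ne_of_mem_erase hs)]

end EmbeddingSums

section PowerSums

variable {N : ℕ}

lemma mul_rootCoeff_compl_zero {R : Type*} [CommRing R] (x : Fin N → R) (i : Fin N) :
    x i * rootCoeff x {i}ᶜ 0 = -rootCoeff x Finset.univ 0 := by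
  rw [← Finset.insert_compl_self i, rootCoeff_insert_zero x (by simp), neg_neg]

lemma mul_rootCoeff_compl_succ {R : Type*} [CommRing R] (x : Fin N → R) (i : Fin N) (k : ℕ) :
    x i * rootCoeff x {i}ᶜ (k + 1) = rootCoeff x {i}ᶜ k - rootCoeff x Finset.univ (k + 1) := by
  rw [← Finset.insert_compl_self i, rootCoeff_insert_succ x (by simp)]
  ring

lemma rootCoeff_compl_pred {R : Type*} [CommRing R] (x : Fin N → R) (i : Fin N) :
    rootCoeff x {i}ᶜ (N - 1) = 1 := by
  have := rootCoeff_card x ({i}ᶜ : Finset (Fin N))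
  rwa [Finset.card_compl, Finset.card_singleton, Fintype.card_fin] at this

lemma puncturedSum_succ_inl_zero (s t l : ℕ) :
    puncturedSum N (s + 1) t l 0 = -(rootCoeff (fun i => X (Sum.inl i)) Finset.univ 0 *
      puncturedSum N s t l (N - 1)) := by
  rw [puncturedSum, puncturedSum, Finset.mul_sum, ← Finset.sum_neg_distrib]
  refine Finset.sum_congr rfl fun i _ => ?_
  rw [rootCoeff_compl_pred]
  linear_combination X (Sum.inl i) ^ s * X (Sum.inr i) ^ t *
    rootCoeff (fun i => X (Sum.inr i)) {i}ᶜ l *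
      mul_rootCoeff_compl_zero (fun i => (X (Sum.inl i) : Rzl N)) i

lemma puncturedSum_succ_inl_succ (s t l k : ℕ) :
    puncturedSum N (s + 1) t l (k + 1) = puncturedSum N s t l k -
      rootCoeff (fun i => X (Sum.inl i)) Finset.univ (k + 1) * puncturedSum N s t l (N - 1) := by
  rw [puncturedSum, puncturedSum, puncturedSum, Finset.mul_sum, ← Finset.sum_sub_distrib]
  refine Finset.sum_congr rfl fun i _ => ?_
  rw [rootCoeff_compl_pred]
  linear_combination X (Sum.inl i) ^ s * X (Sum.inr i) ^ t *
    rootCoeff (fun i => X (Sum.inr i)) {i}ᶜ l *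
      mul_rootCoeff_compl_succ (fun i => (X (Sum.inl i) : Rzl N)) i k

lemma puncturedSum_succ_inr_zero (s t k : ℕ) :
    puncturedSum N s (t + 1) 0 k = -(rootCoeff (fun i => X (Sum.inr i)) Finset.univ 0 *
      puncturedSum N s t (N - 1) k) := by
  rw [puncturedSum, puncturedSum, Finset.mul_sum, ← Finset.sum_neg_distrib]
  refine Finset.sum_congr rfl fun i _ => ?_
  rw [rootCoeff_compl_pred]
  linear_combination X (Sum.inl i) ^ s * X (Sum.inr i) ^ t *
    rootCoeff (fun i => X (Sum.inl i)) {i}ᶜ k *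
      mul_rootCoeff_compl_zero (fun i => (X (Sum.inr i) : Rzl N)) i

lemma puncturedSum_succ_inr_succ (s t l k : ℕ) :
    puncturedSum N s (t + 1) (l + 1) k = puncturedSum N s t l k -
      rootCoeff (fun i => X (Sum.inr i)) Finset.univ (l + 1) * puncturedSum N s t (N - 1) k := by
  rw [puncturedSum, puncturedSum, puncturedSum, Finset.mul_sum, ← Finset.sum_sub_distrib]
  refine Finset.sum_congr rfl fun i _ => ?_
  rw [rootCoeff_compl_pred]
  linear_combination X (Sum.inl i) ^ s * X (Sum.inr i) ^ t *
    rootCoeff (fun i => X (Sum.inl i)) {i}ᶜ k *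
      mul_rootCoeff_compl_succ (fun i => (X (Sum.inr i) : Rzl N)) i l

lemma puncturedSum_pred_pred (s t : ℕ) : puncturedSum N s t (N - 1) (N - 1) =
    ∑ i, X (Sum.inl i) ^ s * X (Sum.inr i) ^ t := by
  simp only [puncturedSum, rootCoeff_compl_pred, mul_one]

variable {𝒜 : Subalgebra ℂ (Module.End ℂ (Rzl N))}

lemma rootCoeff_mem_symbols {x : Fin N → Fin N ⊕ Fin N} {k n : ℕ} (h : N = n + k)
    (hA : mulP N (rootCoeff (fun i => X (x i)) Finset.univ k) ∈ 𝒜) :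
    rootCoeff (fun i => X (x i)) Finset.univ k ∈ symbols 𝒜 n :=
  ⟨_, hA, hasSymbol_mulP (rootCoeff_X_mem_degreeBelow x _ (by
    rw [Finset.card_univ, Fintype.card_fin]
    omega))⟩

/-- An algebra of operators that realizes the symbols of the generators of the center. -/
structure HasCentralSymbols (𝒜 : Subalgebra ℂ (Module.End ℂ (Rzl N))) : Prop where
  inl_mem : ∀ k ≤ N, mulP N (rootCoeff (fun i => X (Sum.inl i)) Finset.univ k) ∈ 𝒜
  inr_mem : ∀ l ≤ N, mulP N (rootCoeff (fun i => X (Sum.inr i)) Finset.univ l) ∈ 𝒜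
  punctured_mem : ∀ d l k, l < N → k < N → d + l + k + 2 = 2 * N →
    puncturedSum N 0 0 l k ∈ symbols 𝒜 d

lemma HasCentralSymbols.puncturedSum_mem (h : HasCentralSymbols 𝒜) (s t : ℕ) {d l k : ℕ}
    (hl : l < N) (hk : k < N) (hd : d + l + k + 2 = s + t + 2 * N) :
    puncturedSum N s t l k ∈ symbols 𝒜 d := by
  induction s generalizing d k with
  | zero =>
    induction t generalizing d l with
    | zero => exact h.punctured_mem d l k hl hk (by omega)
    | succ t ih =>
      rcases l with _ | l
      · rw [puncturedSum_succ_inr_zero]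
        exact neg_mem (mul_mem_symbols (rootCoeff_mem_symbols (n := N) (by omega)
          (h.inr_mem 0 (by omega))) (ih (l := N - 1) (d := d - N) (by omega) (by omega))
            (by omega))
      · rw [puncturedSum_succ_inr_succ]
        exact sub_mem (ih (by omega) (by omega)) (mul_mem_symbols
          (rootCoeff_mem_symbols (n := N - (l + 1)) (by omega) (h.inr_mem _ (by omega)))
            (ih (l := N - 1) (d := d - (N - (l + 1))) (by omega) (by omega)) (by omega))
  | succ s ih =>
    rcases k with _ | k
    · rw [puncturedSum_succ_inl_zero]
      exact neg_mem (mul_mem_symbols (rootCoeff_mem_symbols (n := N) (by omega)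
        (h.inl_mem 0 (by omega))) (ih (k := N - 1) (d := d - N) (by omega) (by omega)) (by omega))
    · rw [puncturedSum_succ_inl_succ]
      exact sub_mem (ih (by omega) (by omega)) (mul_mem_symbols
        (rootCoeff_mem_symbols (n := N - (k + 1)) (by omega) (h.inl_mem _ (by omega)))
          (ih (k := N - 1) (d := d - (N - (k + 1))) (by omega) (by omega)) (by omega))

/-- The monomial `z_i^a λ_i^b`. -/
def pairMonomial (N : ℕ) (w : ℕ × ℕ) (i : Fin N) : Rzl N :=
  X (Sum.inl i) ^ w.1 * X (Sum.inr i) ^ w.2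

lemma pairMonomial_add (a b : ℕ × ℕ) (i : Fin N) :
    pairMonomial N (a + b) i = pairMonomial N a i * pairMonomial N b i := by
  simp only [pairMonomial, Prod.fst_add, Prod.snd_add]
  ring

lemma HasCentralSymbols.sum_pairMonomial_mem (h : HasCentralSymbols 𝒜) (w : ℕ × ℕ) :
    ∑ i, pairMonomial N w i ∈ symbols 𝒜 (w.1 + w.2) := by
  rcases Nat.eq_zero_or_pos N with rfl | hN
  · simp
  · simp only [pairMonomial]
    rw [← puncturedSum_pred_pred]
    exact h.puncturedSum_mem _ _ (by omega) (by omega) (by omega)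

lemma HasCentralSymbols.embeddingSum_mem (h : HasCentralSymbols 𝒜) {k : ℕ}
    (w : Fin k → ℕ × ℕ) {d : ℕ} (hd : ∑ t, ((w t).1 + (w t).2) = d) :
    embeddingSum (pairMonomial N) w ∈ symbols 𝒜 d := by
  subst hd
  induction k with
  | zero =>
    have : embeddingSum (pairMonomial N) w = 1 := by simp [embeddingSum]
    rw [this]
    exact one_mem_symbols
  | succ k ih =>
    rw [embeddingSum_succ pairMonomial_add]
    refine sub_mem (mul_mem_symbols (h.sum_pairMonomial_mem _) (ih _)
      (Fin.sum_univ_succ fun t => (w t).1 + (w t).2).symm)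
      (Submodule.sum_mem _ fun t _ => ?_)
    convert ih (Function.update (fun t => w t.succ) t (w 0 + w t.succ)) using 2
    rw [Fin.sum_univ_succ,
      ← Finset.add_sum_erase _ (fun s : Fin k => (w s.succ).1 + (w s.succ).2) (Finset.mem_univ t),
      ← Finset.add_sum_erase _ (fun s => (Function.update (fun t => w t.succ) t
        (w 0 + w t.succ) s).1 + (Function.update (fun t => w t.succ) t (w 0 + w t.succ) s).2)
        (Finset.mem_univ t),
      Function.update_self, Prod.fst_add, Prod.snd_add]
    have : ∀ s ∈ Finset.univ.erase t,
        (Function.update (fun t => w t.succ) t (w 0 + w t.succ) s).1 +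
          (Function.update (fun t => w t.succ) t (w 0 + w t.succ) s).2 =
            (w s.succ).1 + (w s.succ).2 := fun s hs => by
      rw [Function.update_of_ne (Finset.ne_of_mem_erase hs)]
    rw [Finset.sum_congr rfl this]
    ring

lemma embeddingSum_eq_sum_rename (μ : Fin N ⊕ Fin N →₀ ℕ) :
    embeddingSum (pairMonomial N) (fun t => (μ (Sum.inl t), μ (Sum.inr t))) =
      ∑ σ : Equiv.Perm (Fin N), rename (Sum.map σ σ) (monomial μ (1 : ℂ)) := by
  rw [embeddingSum]
  refine Fintype.sum_bijective Function.Embedding.equivOfFiniteSelfEmbedding ?_ _ _ fun e => ?_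
  · refine ⟨fun e f hef => ?_, fun σ => ⟨σ.toEmbedding, ?_⟩⟩
    · rw [← Function.Embedding.toEmbedding_equivOfFiniteSelfEmbedding e, hef,
        Function.Embedding.toEmbedding_equivOfFiniteSelfEmbedding]
    · ext
      rfl
  · rw [monomial_eq, C_1, one_mul, Finsupp.prod_fintype _ _ (fun _ => pow_zero _),
      Fintype.prod_sum_type, map_mul, map_prod, map_prod, ← Finset.prod_mul_distrib]
    refine Finset.prod_congr rfl fun t _ => ?_
    rw [map_pow, map_pow, rename_X, rename_X]
    rfl

lemma HasCentralSymbols.sum_rename_mem (h : HasCentralSymbols 𝒜) (μ : Fin N ⊕ Fin N →₀ ℕ) :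
    ∑ σ : Equiv.Perm (Fin N), rename (Sum.map σ σ) (monomial μ (1 : ℂ)) ∈
      symbols 𝒜 μ.degree := by
  rw [← embeddingSum_eq_sum_rename]
  refine h.embeddingSum_mem _ ?_
  rw [Finsupp.degree_eq_sum, Fintype.sum_sum_type, ← Finset.sum_add_distrib]

end PowerSums

section CenterGenerators

variable {N : ℕ} {𝒜 : Subalgebra ℂ (Module.End ℂ (Rzl N))}

lemma factorial_smul_eq_sum_rename {f : Rzl N}
    (hf : ∀ σ : Equiv.Perm (Fin N), rename (Sum.map σ σ) f = f) :
    (N.factorial : ℂ) • f = ∑ μ ∈ f.support, coeff μ f •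
      ∑ σ : Equiv.Perm (Fin N), rename (Sum.map σ σ) (monomial μ (1 : ℂ)) := by
  have h1 : ∑ σ : Equiv.Perm (Fin N), rename (Sum.map σ σ) f = (N.factorial : ℂ) • f := by
    rw [Finset.sum_congr rfl fun σ _ => hf σ, Finset.sum_const, Finset.card_univ,
      Fintype.card_perm, Fintype.card_fin, Nat.cast_smul_eq_nsmul]
  rw [← h1]
  conv_lhs => enter [2, σ]; rw [f.as_sum]
  simp only [map_sum, Finset.smul_sum]
  rw [Finset.sum_comm]
  refine Finset.sum_congr rfl fun μ _ => Finset.sum_congr rfl fun σ _ => ?_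
  rw [← map_smul, smul_monomial, smul_eq_mul, mul_one]

lemma HasCentralSymbols.exists_apply_one_eq (h : HasCentralSymbols 𝒜)
    (hinv : ∀ A ∈ 𝒜, ∀ σ : Equiv.Perm (Fin N), rename (Sum.map σ σ) (A 1) = A 1) {f : Rzl N}
    (hf : ∀ σ : Equiv.Perm (Fin N), rename (Sum.map σ σ) f = f) : ∃ A ∈ 𝒜, A 1 = f := by
  obtain ⟨n, hn⟩ := exists_mem_degreeBelow f
  induction n generalizing f with
  | zero => exact ⟨0, zero_mem _, by rw [eq_zero_of_mem_degreeBelow hn, LinearMap.zero_apply]⟩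
  | succ n ih =>
    let E : Submodule ℂ (Rzl N) := (Subalgebra.toSubmodule 𝒜).map (LinearMap.applyₗ (1 : Rzl N))
    have hE : (N.factorial : ℂ) • f ∈ E ⊔ degreeBelow (Fin N ⊕ Fin N) n := by
      rw [factorial_smul_eq_sum_rename hf]
      refine Submodule.sum_mem _ fun μ hμ => Submodule.smul_mem _ _ ?_
      obtain ⟨A, hA, hs⟩ := h.sum_rename_mem μ
      refine Submodule.mem_sup.2 ⟨A 1, ⟨A, hA, rfl⟩, _, ?_, add_sub_cancel (A 1) _⟩
      rw [← neg_sub]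
      exact neg_mem (degreeBelow_mono (Nat.lt_succ_iff.1 (mem_degreeBelow.1 hn μ hμ))
        hs.apply_one_sub_mem)
    have hE' : f ∈ E ⊔ degreeBelow (Fin N ⊕ Fin N) n := by
      have := Submodule.smul_mem _ ((N.factorial : ℂ)⁻¹) hE
      rwa [smul_smul, inv_mul_cancel₀ (Nat.cast_ne_zero.2 N.factorial_ne_zero), one_smul] at this
    obtain ⟨_, ⟨A, hA, rfl⟩, g, hg, hAg⟩ := Submodule.mem_sup.1 hE'
    change A 1 + g = f at hAg
    obtain ⟨B, hB, hBg⟩ := ih (f := g) (fun σ => by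
      rw [← add_right_inj (A 1), hAg, ← hf σ, ← hAg, map_add, hinv A hA σ]) hg
    exact ⟨A + B, add_mem hA hB, by rw [LinearMap.add_apply, hBg, hAg]⟩

variable {D : Fin N → Fin N → Rzl N → Rzl N} {K : Fin N → Module.End ℂ (Rzl N)}

lemma rename_apply_one_of_mem_center {Z : Module.End ℂ (Rzl N)} (hZ : Z ∈ cherednikCenter N K)
    (σ : Equiv.Perm (Fin N)) : rename (Sum.map σ σ) (Z 1) = Z 1 := by
  have := LinearMap.congr_fun (hZ.2 _ (permRep_mem_cherednik σ)) 1
  rw [Module.End.mul_apply, Module.End.mul_apply, permRep_apply, permRep_apply,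
    map_one (rename (R := ℂ) (Sum.map σ σ))] at this
  exact this

/-- A central element is determined by its value at `1`. -/
lemma IsDunkl.eq_of_mem_center (h : IsDunkl D K) {Y Z : Module.End ℂ (Rzl N)}
    (hY : Y ∈ cherednikCenter N K) (hZ : Z ∈ cherednikCenter N K) (hYZ : Y 1 = Z 1) : Y = Z := by
  refine eq_of_commute_of_eqOn (fun k => (hY.2 _ (mulP_X_inr_mem_cherednik k)).symm)
    (fun k => (hZ.2 _ (mulP_X_inr_mem_cherednik k)).symm) fun p => ?_
  induction p using MvPolynomial.induction_on with
  | C a =>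
    have : rename Sum.inl (C a) = a • (1 : Rzl N) := by
      rw [rename_C, smul_eq_C_mul, mul_one]
    rw [this, map_smul, map_smul, hYZ]
  | add p q hp hq => rw [map_add, map_add, map_add, hp, hq]
  | mul_X p i hp =>
    have h1 := LinearMap.congr_fun (hY.2 _ (mem_cherednik i)) (rename Sum.inl p)
    have h2 := LinearMap.congr_fun (hZ.2 _ (mem_cherednik i)) (rename Sum.inl p)
    rw [Module.End.mul_apply, Module.End.mul_apply, h.apply_rename_inl] at h1 h2
    rw [mul_comm, ← h1, ← h2, hp]

lemma IsDunkl.adjoin_coeff_eq_center (h : IsDunkl D K)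
    {c : Fin (N + 1) → Fin (N + 1) → Module.End ℂ (Rzl N)}
    (hc : ∀ u v : ℂ, Puv K u v = ∑ i : Fin (N + 1), ∑ j : Fin (N + 1),
        (v ^ (N - (i : ℕ)) * u ^ (N - (j : ℕ))) • c i j) :
    Algebra.adjoin ℂ (Set.range fun x : Fin (N + 1) × Fin (N + 1) => c x.1 x.2) =
      cherednikCenter N K := by
  have hle : Algebra.adjoin ℂ (Set.range fun x : Fin (N + 1) × Fin (N + 1) => c x.1 x.2) ≤
      cherednikCenter N K := by
    refine Algebra.adjoin_le ?_
    rintro _ ⟨x, rfl⟩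
    exact h.coeff_mem_center hc x.1 x.2
  refine le_antisymm hle fun Z hZ => ?_
  have hA : ∀ i j, c i j ∈
      Algebra.adjoin ℂ (Set.range fun x : Fin (N + 1) × Fin (N + 1) => c x.1 x.2) :=
    fun i j => Algebra.subset_adjoin ⟨(i, j), rfl⟩
  have hs : HasCentralSymbols
      (Algebra.adjoin ℂ (Set.range fun x : Fin (N + 1) × Fin (N + 1) => c x.1 x.2)) :=
    ⟨fun k hk => h.mulP_rootCoeff_inl_mem hc hA hk, fun l hl => h.mulP_rootCoeff_inr_mem hc hA hl,
      fun d l k hl hk hd => h.puncturedSum_mem_symbols hc hA hl hk hd⟩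
  obtain ⟨A, hmem, hAZ⟩ := hs.exists_apply_one_eq
    (fun A hA σ => rename_apply_one_of_mem_center (hle hA) σ)
    (fun σ => rename_apply_one_of_mem_center hZ σ)
  exact h.eq_of_mem_center (hle hmem) hZ hAZ ▸ hmem

end CenterGenerators

set_option synthInstance.maxHeartbeats 1000000 in
/-- The operators `b̄_ij` pairwise commute, and `b̄_ij ↦ c_ij` is an algebra
isomorphism from the Bethe algebra onto the center of the Cherednik algebra. -/
theorem stmt9 (N : ℕ) (hN : 0 < N)
    (D : Fin N → Fin N → Rzl N → Rzl N)
    (hD : ∀ i j : Fin N, i ≠ j → ∀ p : Rzl N,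
      (X (Sum.inr i) - X (Sum.inr j)) * D i j p = p - sL N i j p)
    (K : Fin N → Module.End ℂ (Rzl N))
    (hK : ∀ (i : Fin N) (p : Rzl N),
      K i p = X (Sum.inl i) * p + ∑ j ∈ Finset.univ.erase i, sZ N i j (D i j p))
    (c : Fin (N + 1) → Fin (N + 1) → Module.End ℂ (Rzl N))
    (hc : ∀ u v : ℂ, Puv K u v =
      ∑ i : Fin (N + 1), ∑ j : Fin (N + 1),
        (v ^ (N - (i : ℕ)) * u ^ (N - (j : ℕ))) • c i j)
    (bb : Fin (N + 1) → Fin (N + 1) → Module.End ℂ (V1 N))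
    (hb : ∀ u v : ℂ, PB N u v =
      ∑ i : Fin (N + 1), ∑ j : Fin (N + 1),
        (u ^ (N - (i : ℕ)) * v ^ (N - (j : ℕ))) • bb i j) :
    (∀ i j k l : Fin (N + 1), Commute (bb i j) (bb k l)) ∧
    ∃ φ : (Algebra.adjoin ℂ
            {x : Module.End ℂ (V1 N) | ∃ i j : Fin (N + 1), x = bb i j}) ≃ₐ[ℂ]
          (cherednikCenter N K),
      ∀ (i j : Fin (N + 1))
        (h : bb i j ∈ Algebra.adjoin ℂ
          {x : Module.End ℂ (V1 N) | ∃ i j : Fin (N + 1), x = bb i j}),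
        (↑(φ ⟨bb i j, h⟩) : Module.End ℂ (Rzl N)) = c i j := by
  have h : IsDunkl D K := ⟨hD, hK⟩
  have hset : {x : Module.End ℂ (V1 N) | ∃ i j : Fin (N + 1), x = bb i j} =
      Set.range fun x : Fin (N + 1) × Fin (N + 1) => bb x.1 x.2 := by
    ext x
    exact ⟨fun ⟨i, j, hx⟩ => ⟨(i, j), hx.symm⟩, fun ⟨y, hy⟩ => ⟨y.1, y.2, hy.symm⟩⟩
  refine ⟨fun i j k l => commute_of_lift_eq_zero_iff (x := (i, j)) (y := (k, l))
    (h.lift_eq_zero_iff hc hb)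
    (commute_of_mem_center (h.coeff_mem_center hc i j) (h.coeff_mem_center hc k l)), ?_⟩
  obtain ⟨φ, hφ⟩ := exists_equiv_of_lift_eq_zero_iff (h.lift_eq_zero_iff hc hb)
  rw [hset]
  exact ⟨φ.trans (Subalgebra.equivOfEq _ _ (h.adjoin_coeff_eq_center hc)),
    fun i j hij => hφ (i, j) hij⟩
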